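/- Let T = {1,2,…,n}. For every partition λ of n, the multiplicity of the irreducible representation ρ^λ of the symmetric group 𝔖_n in the virtual representation β_{P_n}(T) is equal to the number of standard Young tableaux Q of shape λ for which the smallest element of Des(Q) ∪ {n} is even. -/

import Mathlib

open scoped Classical

noncomputable section

/-! ### Permutation combinatorics -/

/-- The value `w(i)` (1-based, in `{1,…,n}`) of a permutation `w` of `{1,…,n}`,
realized as `Equiv.Perm (Fin n)`. -/
def permApp {n : ℕ} (w : Equiv.Perm (Fin n)) (i : ℕ) : ℕ :=
  if h : i - 1 < n then (w ⟨i - 1, h⟩ : ℕ) + 1 else 0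

/-- The descent set of a permutation, a subset of `{1,…,n-1}`. -/
def descentSet {n : ℕ} (w : Equiv.Perm (Fin n)) : Finset ℕ :=
  (Finset.Icc 1 (n - 1)).filter fun i => permApp w (i + 1) < permApp w i

/-- `numDescentSet m T` is the number of permutations in `𝔖_m` with descent set `T`. -/
def numDescentSet (m : ℕ) (T : Finset ℕ) : ℕ :=
  Nat.card {w : Equiv.Perm (Fin m) // descentSet w = T}

/-- The Coxeter length (number of inversions) of a permutation. -/
def invCount {n : ℕ} (w : Equiv.Perm (Fin n)) : ℕ :=
  (Finset.univ.filter fun p : Fin n × Fin n => p.1 < p.2 ∧ w p.2 < w p.1).card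

/-- For `S = {s_1 < s_2 < ⋯ < s_k} ⊆ {1,…,n-1}`, `sElt n S j = s_j`, with the
conventions `s_0 = 0` and `s_j = n` for `j > k`. -/
def sElt (n : ℕ) (S : Finset ℕ) (j : ℕ) : ℕ :=
  if j = 0 then 0 else if j ≤ S.card then (S.sort (· ≤ ·)).getD (j - 1) 0 else n

lemma sElt_of_gt (n : ℕ) (S : Finset ℕ) (j : ℕ) (h : S.card < j) : sElt n S j = n := by
  unfold sElt
  rw [if_neg (by omega), if_neg (by omega)]

/-! ### Standard Young tableaux -/

/-- A standard Young tableau of shape `μ`: a filling of the cells of `μ` by the numbers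
`1,…,μ.card`, each used once, strictly increasing along rows and columns
(the entry of a non-cell is `0`). -/
structure SYT (μ : YoungDiagram) where
  entry : ℕ → ℕ → ℕ
  entry_eq_zero : ∀ i j, (i, j) ∉ μ → entry i j = 0
  row_strict : ∀ i j1 j2, j1 < j2 → (i, j2) ∈ μ → entry i j1 < entry i j2
  col_strict : ∀ i1 i2 j, i1 < i2 → (i2, j) ∈ μ → entry i1 j < entry i2 j
  bijOn : Set.BijOn (fun p : ℕ × ℕ => entry p.1 p.2) ↑μ.cells ↑(Finset.Icc 1 μ.card)

/-- The descent set of a standard Young tableau: those `k` such that `k+1` lies in a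
strictly lower row than `k`. -/
def SYT.des {μ : YoungDiagram} (Q : SYT μ) : Finset ℕ :=
  (Finset.Icc 1 (μ.card - 1)).filter fun k =>
    ∃ p1 ∈ μ.cells, ∃ p2 ∈ μ.cells,
      Q.entry p1.1 p1.2 = k ∧ Q.entry p2.1 p2.2 = k + 1 ∧ p1.1 < p2.1

/-- `fSYTRow μ t` is the number of standard Young tableaux of shape `μ` whose first row
contains the numbers `1,…,t`. -/
def fSYTRow (μ : YoungDiagram) (t : ℕ) : ℕ :=
  Nat.card {Q : SYT μ // ∀ k, 1 ≤ k → k ≤ t → ∃ j, (0, j) ∈ μ ∧ Q.entry 0 j = k}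

/-! ### Irreducible characters of the symmetric group, via Jacobi–Trudi -/

/-- The number of functions `f : Fin n → Fin k` which are invariant under `g` and whose
fiber over `i` has `c i` elements.  For `c` a composition of `n`, the function
`g ↦ fixedYoungFns n k c g` is the character of the permutation representation of `𝔖_n`
on ordered set partitions of `{1,…,n}` of type `c`, i.e. of the representation induced
from the trivial representation of the corresponding Young subgroup. -/
def fixedYoungFns (n k : ℕ) (c : Fin k → ℤ) (g : Equiv.Perm (Fin n)) : ℕ :=
  Nat.card {f : Fin n → Fin k //
    (∀ x, f (g x) = f x) ∧ ∀ i, ((Nat.card {x : Fin n // f x = i} : ℕ) : ℤ) = c i}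

/-- The irreducible character `χ^μ` of `𝔖_n` associated to a partition `μ` of `n`
(encoded as a Young diagram with `n` cells), defined through the Jacobi–Trudi
determinantal formula `χ^μ = det (h_{μ_i - i + j})`. -/
def chi (n : ℕ) (μ : YoungDiagram) (g : Equiv.Perm (Fin n)) : ℤ :=
  ∑ σ : Equiv.Perm (Fin μ.rowLens.length),
    ((Equiv.Perm.sign σ : ℤˣ) : ℤ) *
      (fixedYoungFns n μ.rowLens.length
        (fun i => ((μ.rowLen (i : ℕ) : ℕ) : ℤ) - ((i : ℕ) : ℤ) + ((σ i : ℕ) : ℤ)) g : ℤ)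

/-! ### Posets, rank selection, maximal chains and characters -/

/-- The maximal chains of the subposet induced on a subset `A` of a poset. -/
def maxChainsIn {P : Type*} [Preorder P] (A : Set P) : Set (Set P) :=
  {C | C ⊆ A ∧ IsChain (· ≤ ·) C ∧
    ∀ D : Set P, D ⊆ A → IsChain (· ≤ ·) D → C ⊆ D → C = D}

/-- The rank-selected subposet `P_S = {x ∈ P : rk x ∈ S} ∪ {⊥, ⊤}`. -/
def rankSel {P : Type*} [Preorder P] [OrderBot P] [OrderTop P] (rk : P → ℕ)
    (S : Finset ℕ) : Set P :=
  {x | rk x ∈ S} ∪ {⊥, ⊤}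

/-- `a_P(S)`: the number of maximal chains of the rank-selected subposet `P_S`. -/
def chainCount {P : Type*} [Preorder P] [OrderBot P] [OrderTop P] (rk : P → ℕ)
    (S : Finset ℕ) : ℕ :=
  Set.ncard (maxChainsIn (rankSel rk S))

/-- `b_P(S) = Σ_{T ⊆ S} (-1)^{|S-T|} a_P(T)`. -/
def bDim {P : Type*} [Preorder P] [OrderBot P] [OrderTop P] (rk : P → ℕ)
    (S : Finset ℕ) : ℤ :=
  ∑ T ∈ S.powerset, (-1 : ℤ) ^ (S.card - T.card) * (chainCount rk T : ℤ)

/-- The character of the permutation representation `α_P(S)` of a group `G` acting (via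
`act`) on the maximal chains of the rank-selected subposet `P_S`: its value at `g` is
the number of maximal chains of `P_S` fixed by `g`. -/
def gAlpha {P G : Type*} [Preorder P] [OrderBot P] [OrderTop P] (rk : P → ℕ)
    (act : G → P → P) (S : Finset ℕ) (g : G) : ℤ :=
  (Set.ncard {C : Set P | C ∈ maxChainsIn (rankSel rk S) ∧ act g '' C = C} : ℤ)

/-- The character of the virtual representation
`β_P(S) = Σ_{T ⊆ S} (-1)^{|S-T|} α_P(T)`. -/
def gBeta {P G : Type*} [Preorder P] [OrderBot P] [OrderTop P] (rk : P → ℕ)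
    (act : G → P → P) (S : Finset ℕ) (g : G) : ℤ :=
  ∑ T ∈ S.powerset, (-1 : ℤ) ^ (S.card - T.card) * gAlpha rk act T g

/-! ### The poset of injective words -/

/-- An injective word over the alphabet `{1,…,n}`. -/
def InjWord (n : ℕ) : Type := {l : List (Fin n) // l.Nodup}

instance (n : ℕ) : PartialOrder (InjWord n) where
  le u v := u.1.Sublist v.1
  le_refl u := List.Sublist.refl _
  le_trans u v w h1 h2 := List.Sublist.trans h1 h2
  le_antisymm u v h1 h2 := Subtype.ext (List.Sublist.antisymm h1 h2)

instance (n : ℕ) : OrderBot (InjWord n) where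
  bot := ⟨[], List.nodup_nil⟩
  bot_le u := List.nil_sublist u.1

/-- The rank function of the poset of injective words (with a maximum adjoined):
the rank of a word is its length, and the rank of `⊤` is `n+1`. -/
def rkInj (n : ℕ) (x : WithTop (InjWord n)) : ℕ :=
  WithTop.recTopCoe (n + 1) (fun u => u.1.length) x

/-- The action of `𝔖_n` on injective words, letter by letter. -/
def permWord {n : ℕ} (w : Equiv.Perm (Fin n)) (u : InjWord n) : InjWord n :=
  ⟨u.1.map w, u.2.map w.injective⟩

/-- The character of `α_{P_n}(S)` for the `𝔖_n`-action on the poset of injective words. -/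
def injAlpha (n : ℕ) (S : Finset ℕ) (g : Equiv.Perm (Fin n)) : ℤ :=
  gAlpha (rkInj n) (fun w : Equiv.Perm (Fin n) => WithTop.map (permWord w)) S g

/-- The character of `β_{P_n}(S)` for the `𝔖_n`-action on the poset of injective words. -/
def injBeta (n : ℕ) (S : Finset ℕ) (g : Equiv.Perm (Fin n)) : ℤ :=
  gBeta (rkInj n) (fun w : Equiv.Perm (Fin n) => WithTop.map (permWord w)) S g

/-! ### The poset of r-colored injective words -/

/-- An `r`-colored injective word over `{1,…,n}`: a word in the alphabet
`{1,…,n} × ℤ_r` whose letters have pairwise distinct first coordinates. -/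
def CInjWord (n r : ℕ) : Type := {l : List (Fin n × ZMod r) // (l.map Prod.fst).Nodup}

instance (n r : ℕ) : PartialOrder (CInjWord n r) where
  le u v := u.1.Sublist v.1
  le_refl u := List.Sublist.refl _
  le_trans u v w h1 h2 := List.Sublist.trans h1 h2
  le_antisymm u v h1 h2 := Subtype.ext (List.Sublist.antisymm h1 h2)

instance (n r : ℕ) : OrderBot (CInjWord n r) where
  bot := ⟨[], by simp⟩
  bot_le u := List.nil_sublist u.1

/-- The rank function of the poset `P_{n,r}` of `r`-colored injective words
(with a maximum adjoined). -/
def rkC (n r : ℕ) (x : WithTop (CInjWord n r)) : ℕ :=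
  WithTop.recTopCoe (n + 1) (fun u => u.1.length) x

/-- The action of `𝔖_n` on `r`-colored injective words: act on the first coordinate
of each letter, leaving colors unchanged. -/
def permCWord {n r : ℕ} (w : Equiv.Perm (Fin n)) (u : CInjWord n r) : CInjWord n r :=
  ⟨u.1.map (fun p => (w p.1, p.2)), by
    have h := u.2.map w.injective
    rw [List.map_map] at h ⊢
    exact h⟩

/-- The character of `α_{P_{n,r}}(S)`. -/
def cAlpha (n r : ℕ) (S : Finset ℕ) (g : Equiv.Perm (Fin n)) : ℤ :=
  gAlpha (rkC n r) (fun w : Equiv.Perm (Fin n) => WithTop.map (permCWord w)) S g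

/-- The character of `β_{P_{n,r}}(S)`. -/
def cBeta (n r : ℕ) (S : Finset ℕ) (g : Equiv.Perm (Fin n)) : ℤ :=
  gBeta (rkC n r) (fun w : Equiv.Perm (Fin n) => WithTop.map (permCWord w)) S g

/-- `b_{P_{n,r}}(S)`, the dimension of `β_{P_{n,r}}(S)`. -/
def cChainDim (n r : ℕ) (S : Finset ℕ) : ℤ := bDim (rkC n r) S

/-! ### The statistics τ -/

/-- `τ(w,Q)` for a permutation `w` with descent set `S = {s_1 < ⋯ < s_k}` and a standard
Young tableau `Q`: the largest `i ∈ {0,…,k+1}` such that (a) `w(x) = w_S(x)` for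
`x > s_{k+1-i}` and (b) no descent of `Q` is smaller than `n - s_{k+1-i}`. -/
def tau (n : ℕ) (S : Finset ℕ) (wS w : Equiv.Perm (Fin n)) {μ : YoungDiagram}
    (Q : SYT μ) : ℕ :=
  ((Finset.range (S.card + 2)).filter
    (fun i => (∀ x, sElt n S (S.card + 1 - i) < x → x ≤ n → permApp w x = permApp wS x) ∧
      (∀ d ∈ Q.des, n - sElt n S (S.card + 1 - i) ≤ d))).max'
    ⟨0, by
      have hs := sElt_of_gt n S (S.card + 1 - 0) (by omega)
      refine Finset.mem_filter.2 ⟨Finset.mem_range.2 (by omega), ?_, ?_⟩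
      · intro x hx hx'
        rw [hs] at hx
        exact absurd hx (not_lt.2 hx')
      · intro d _
        rw [hs]
        omega⟩

/-- The condition that all the numbers `1,…,t` appear in the first row of the `r`-colored
standard Young tableau `(Q, c)` and are colored with the zero color (the color of the
entry `k` being `c (k-1)`). -/
def zeroFirstRow {μ : YoungDiagram} {r : ℕ} (Q : SYT μ) (c : Fin μ.card → ZMod r)
    (t : ℕ) : Prop :=
  ∀ k : Fin μ.card, (k : ℕ) < t →
    ((∃ j, (0, j) ∈ μ ∧ Q.entry 0 j = (k : ℕ) + 1) ∧ c k = 0)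

/-- `τ(w,Q)` for an `r`-colored standard Young tableau `(Q,c)`. -/
def ctau (n : ℕ) {r : ℕ} (S : Finset ℕ) (wS w : Equiv.Perm (Fin n)) {μ : YoungDiagram}
    (Q : SYT μ) (c : Fin μ.card → ZMod r) : ℕ :=
  ((Finset.range (S.card + 2)).filter
    (fun i => (∀ x, sElt n S (S.card + 1 - i) < x → x ≤ n → permApp w x = permApp wS x) ∧
      zeroFirstRow Q c (n - sElt n S (S.card + 1 - i)))).max'
    ⟨0, by
      have hs := sElt_of_gt n S (S.card + 1 - 0) (by omega)
      refine Finset.mem_filter.2 ⟨Finset.mem_range.2 (by omega), ?_, ?_⟩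
      · intro x hx hx'
        rw [hs] at hx
        exact absurd hx (not_lt.2 hx')
      · rw [hs]
        intro k hk
        exact absurd hk (by omega)⟩

/-- The largest `i ∈ {0,…,n}` such that all the numbers `1,…,i` appear in the first row
of the `r`-colored standard Young tableau `(Q,c)` and are colored with the zero color. -/
def mQ (n : ℕ) {r : ℕ} {μ : YoungDiagram} (Q : SYT μ) (c : Fin μ.card → ZMod r) : ℕ :=
  ((Finset.range (n + 1)).filter (fun i => zeroFirstRow Q c i)).max'
    ⟨0, Finset.mem_filter.2 ⟨Finset.mem_range.2 (by omega),
      fun k hk => absurd hk (by omega)⟩⟩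

/-- The condition, for an `r`-colored permutation `(π, c)` (the color of the entry
`π(x)` in one-line notation being `c (x-1)`), that the entries `π(1),…,π(t)` are in
increasing order and all colored with the zero color. -/
def zeroIncreasing {n r : ℕ} (π : Equiv.Perm (Fin n)) (c : Fin n → ZMod r) (t : ℕ) : Prop :=
  (∀ x y, 1 ≤ x → x < y → y ≤ t → permApp π x < permApp π y) ∧
  ∀ k : Fin n, (k : ℕ) < t → c k = 0

/-- `τ(w,u)` for an `r`-colored permutation `u = (π, c)`. -/
def tauU (n : ℕ) {r : ℕ} (S : Finset ℕ) (wS w : Equiv.Perm (Fin n))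
    (π : Equiv.Perm (Fin n)) (c : Fin n → ZMod r) : ℕ :=
  ((Finset.range (S.card + 2)).filter
    (fun i => (∀ x, sElt n S (S.card + 1 - i) < x → x ≤ n → permApp w x = permApp wS x) ∧
      zeroIncreasing π c (n - sElt n S (S.card + 1 - i)))).max'
    ⟨0, by
      have hs := sElt_of_gt n S (S.card + 1 - 0) (by omega)
      refine Finset.mem_filter.2 ⟨Finset.mem_range.2 (by omega), ?_, ?_, ?_⟩
      · intro x hx hx'
        rw [hs] at hx
        exact absurd hx (not_lt.2 hx')
      · intro x y hx hxy hy
        rw [hs] at hy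
        exact absurd hy (by omega)
      · rw [hs]
        intro k hk
        exact absurd hk (by omega)⟩

/-- The largest `i ∈ {0,…,n}` such that the entries `π(1),…,π(i)` of the `r`-colored
permutation `(π,c)` are in increasing order and all colored with the zero color. -/
def mU (n : ℕ) {r : ℕ} (π : Equiv.Perm (Fin n)) (c : Fin n → ZMod r) : ℕ :=
  ((Finset.range (n + 1)).filter (fun i => zeroIncreasing π c i)).max'
    ⟨0, Finset.mem_filter.2 ⟨Finset.mem_range.2 (by omega),
      fun x y hx hxy hy => absurd hy (by omega),
      fun k hk => absurd hk (by omega)⟩⟩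

/-- `a_m(T)`: the number of chains in the Boolean lattice `B_m` whose elements have
set of ranks (cardinalities) equal to `T`. -/
def boolChains (m : ℕ) (T : Finset ℕ) : ℕ :=
  Nat.card {c : Finset (Finset (Fin m)) //
    IsChain (· ⊆ ·) (↑c : Set (Finset (Fin m))) ∧ c.image Finset.card = T}

end


noncomputable section


/-! ### Burnside counting -/

/-- The number of words of length `k` in `ℓ` letters with content bounded by `c`. -/
def rwWords (k l : ℕ) (c : Fin l → ℤ) : ℕ :=
  Nat.card {w : Fin k → Fin l // ∀ i, ((Nat.card {j : Fin k // w j = i} : ℕ) : ℤ) ≤ c i}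

/-- Pairs of an injective word and a set composition of type `c`. -/
def RWPair (n k l : ℕ) (c : Fin l → ℤ) : Type :=
  {p : (Fin k ↪ Fin n) × (Fin n → Fin l) //
    ∀ i, ((Nat.card {x : Fin n // p.2 x = i} : ℕ) : ℤ) = c i}

lemma rw_card_comp {n l : ℕ} (f : Fin n → Fin l) (g : Equiv.Perm (Fin n)) (i : Fin l) :
    Nat.card {x : Fin n // f (g⁻¹ x) = i} = Nat.card {x : Fin n // f x = i} := by
  apply Nat.card_congr
  exact (g⁻¹).subtypeEquiv (fun a => Iff.rfl)

instance rwAction (n k l : ℕ) (c : Fin l → ℤ) :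
    MulAction (Equiv.Perm (Fin n)) (RWPair n k l c) where
  smul g p := ⟨(p.1.1.trans g.toEmbedding, fun x => p.1.2 (g⁻¹ x)), fun i => by
    rw [← p.2 i]; exact_mod_cast rw_card_comp p.1.2 g i⟩
  one_smul p := by
    apply Subtype.ext
    apply Prod.ext
    · ext j; rfl
    · rfl
  mul_smul g h p := by
    apply Subtype.ext
    apply Prod.ext
    · ext j; rfl
    · funext x
      change p.1.2 ((g * h)⁻¹ x) = p.1.2 (h⁻¹ (g⁻¹ x))
      rw [mul_inv_rev]; rfl

lemma rw_smul_fst {n k l : ℕ} {c : Fin l → ℤ} (g : Equiv.Perm (Fin n)) (p : RWPair n k l c)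
    (j : Fin k) : (g • p).1.1 j = g (p.1.1 j) := rfl

lemma rw_smul_snd {n k l : ℕ} {c : Fin l → ℤ} (g : Equiv.Perm (Fin n)) (p : RWPair n k l c)
    (x : Fin n) : (g • p).1.2 x = p.1.2 (g⁻¹ x) := rfl

instance (n k l : ℕ) (c : Fin l → ℤ) : Finite (RWPair n k l c) := by
  unfold RWPair; infer_instance

lemma rw_exists_perm {X Y : Type*} (f : X → Y) (k : ℕ) :
    ∀ (e e' : Fin k → X), Function.Injective e → Function.Injective e' →
      (∀ j, f (e j) = f (e' j)) →
      ∃ g : Equiv.Perm X, (∀ j, g (e j) = e' j) ∧ ∀ x, f (g x) = f x := by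
  induction k with
  | zero => intro e e' _ _ _; exact ⟨1, fun j => j.elim0, fun x => rfl⟩
  | succ k ih =>
    intro e e' he he' h
    obtain ⟨g, hg, hf⟩ := ih (fun j => e j.succ) (fun j => e' j.succ)
      (he.comp (Fin.succ_injective k)) (he'.comp (Fin.succ_injective k)) (fun j => h j.succ)
    refine ⟨Equiv.swap (g (e 0)) (e' 0) * g, ?_, ?_⟩
    · intro j
      refine Fin.cases ?_ (fun j => ?_) j
      · simp
      · rw [Equiv.Perm.mul_apply, hg j]
        apply Equiv.swap_apply_of_ne_of_ne
        · rw [← hg j]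
          intro h1
          exact Fin.succ_ne_zero j (he (g.injective h1))
        · intro h1
          exact Fin.succ_ne_zero j (he' h1)
    · intro x
      rw [Equiv.Perm.mul_apply]
      by_cases h1 : g x = g (e 0)
      · rw [h1, Equiv.swap_apply_left, ← h 0, ← hf x, h1, hf]
      · by_cases h2 : g x = e' 0
        · rw [h2, Equiv.swap_apply_right, hf, h 0, ← h2, hf]
        · rw [Equiv.swap_apply_of_ne_of_ne h1 h2, hf]

lemma rw_card_orbits (n k l : ℕ) (c : Fin l → ℤ) (hc : ∑ i, c i = n) :
    Nat.card (Quotient (MulAction.orbitRel (Equiv.Perm (Fin n)) (RWPair n k l c))) =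
      rwWords k l c := by
  unfold rwWords
  let F : RWPair n k l c →
      {w : Fin k → Fin l // ∀ i, ((Nat.card {j : Fin k // w j = i} : ℕ) : ℤ) ≤ c i} :=
    fun p => ⟨fun j => p.1.2 (p.1.1 j), fun i => by
      rw [← p.2 i]
      have : Nat.card {j : Fin k // p.1.2 (p.1.1 j) = i} ≤
          Nat.card {x : Fin n // p.1.2 x = i} := by
        apply Nat.card_le_card_of_injective
          (fun j => (⟨p.1.1 j.1, j.2⟩ : {x : Fin n // p.1.2 x = i}))
        intro a b hab
        apply Subtype.ext
        exact p.1.1.injective (congrArg Subtype.val hab)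
      exact_mod_cast this⟩
  have hF : ∀ p q : RWPair n k l c,
      (MulAction.orbitRel (Equiv.Perm (Fin n)) (RWPair n k l c)) p q → F p = F q := by
    rintro p q ⟨g, rfl⟩
    apply Subtype.ext
    funext j
    change (g • q).1.2 ((g • q).1.1 j) = q.1.2 (q.1.1 j)
    rw [rw_smul_fst, rw_smul_snd]; simp
  apply Nat.card_congr
  refine Equiv.ofBijective (Quotient.lift F hF) ⟨?_, ?_⟩
  · intro a b
    refine Quotient.inductionOn₂ a b ?_
    intro p q hpq
    have hpq' : ∀ j, p.1.2 (p.1.1 j) = q.1.2 (q.1.1 j) := fun j =>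
      congrFun (congrArg Subtype.val hpq) j
    have hfib : ∀ i, Nonempty ({x // p.1.2 x = i} ≃ {x // q.1.2 x = i}) := by
      intro i
      rw [← Finite.card_eq]
      have := (p.2 i).trans (q.2 i).symm
      exact_mod_cast this
    have E := fun i => (hfib i).some
    let G : Equiv.Perm (Fin n) := Equiv.ofFiberEquiv E
    have hG : ∀ x, q.1.2 (G x) = p.1.2 x := fun x => Equiv.ofFiberEquiv_map E x
    obtain ⟨g, hg1, hg2⟩ := rw_exists_perm q.1.2 k (fun j => G (p.1.1 j)) q.1.1
      (G.injective.comp p.1.1.injective) q.1.1.injective (fun j => by rw [hG, hpq'])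
    apply Quotient.sound
    apply (MulAction.orbitRel (Equiv.Perm (Fin n)) (RWPair n k l c)).iseqv.symm
    refine ⟨g * G, ?_⟩
    apply Subtype.ext
    apply Prod.ext
    · ext j
      change ((g (G (p.1.1 j)) : Fin n) : ℕ) = _
      rw [hg1]
    · funext x
      change p.1.2 ((g * G)⁻¹ x) = q.1.2 x
      rw [← hG, ← hg2, ← Equiv.Perm.mul_apply]
      simp
  · rintro ⟨w, hw⟩
    have hpos : ∀ i, 0 ≤ c i := fun i => le_trans (by positivity) (hw i)
    have hcard : Fintype.card (Σ i : Fin l, Fin (c i).toNat) = Fintype.card (Fin n) := by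
      simp only [Fintype.card_sigma, Fintype.card_fin]
      have : ((∑ i, (c i).toNat : ℕ) : ℤ) = n := by
        push_cast
        rw [← hc]
        exact Finset.sum_congr rfl fun i _ => by simp [hpos i]
      exact_mod_cast this
    let T := Fintype.equivOfCardEq hcard
    have hem : ∀ i, Nonempty ({j : Fin k // w j = i} ↪ Fin (c i).toNat) := by
      intro i
      apply Function.Embedding.nonempty_of_card_le
      rw [Fintype.card_fin, ← Nat.card_eq_fintype_card]
      have := hw i
      omega
    have φ := fun i => (hem i).some
    let e : Fin k ↪ Fin n := ((Equiv.sigmaFiberEquiv w).symm.toEmbedding.trans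
      (Function.Embedding.sigmaMap (Function.Embedding.refl _) φ)).trans T.toEmbedding
    refine ⟨Quotient.mk _ ⟨(e, fun x => (T.symm x).1), ?_⟩, ?_⟩
    · intro i
      have : Nat.card {x : Fin n // (T.symm x).1 = i} = Nat.card (Fin (c i).toNat) := by
        apply Nat.card_congr
        refine (T.symm.subtypeEquiv (q := fun y => y.1 = i) (fun a => Iff.rfl)).trans ?_
        exact Equiv.sigmaSubtype i
      change ((Nat.card {x : Fin n // (T.symm x).1 = i} : ℕ) : ℤ) = c i
      rw [this, Nat.card_fin]
      have := hpos i
      omega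
    · apply Subtype.ext
      funext j
      change (T.symm (e j)).1 = w j
      simp only [e, Function.Embedding.trans_apply, Equiv.coe_toEmbedding, Equiv.symm_apply_apply]
      rfl

lemma rw_burnside (n k l : ℕ) (c : Fin l → ℤ) (hc : ∑ i, c i = n) :
    ∑ g : Equiv.Perm (Fin n),
      (Nat.card {e : Fin k ↪ Fin n // ∀ j, g (e j) = e j} : ℤ) *
        (fixedYoungFns n l c g⁻¹ : ℤ) = (rwWords k l c : ℤ) * (n.factorial : ℤ) := by
  have : Fintype (RWPair n k l c) := Fintype.ofFinite _
  have h := MulAction.sum_card_fixedBy_eq_card_orbits_mul_card_group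
    (Equiv.Perm (Fin n)) (RWPair n k l c)
  rw [← Nat.card_eq_fintype_card (α := Quotient _), rw_card_orbits n k l c hc,
    Fintype.card_perm, Fintype.card_fin] at h
  rw [← Nat.cast_mul, ← h, Nat.cast_sum]
  refine Finset.sum_congr rfl fun g _ => ?_
  rw [← Nat.cast_mul, ← Nat.card_eq_fintype_card]
  unfold fixedYoungFns
  rw [← Nat.card_prod]
  congr 1
  apply Nat.card_congr
  refine ⟨fun p => ⟨⟨(p.1.1, p.2.1), p.2.2.2⟩, ?_⟩,
    fun q => (⟨q.1.1.1, fun j => ?_⟩, ⟨q.1.1.2, fun x => ?_, q.1.2⟩), ?_, ?_⟩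
  · apply Subtype.ext
    apply Prod.ext
    · ext j
      exact congrArg Fin.val (p.1.2 j)
    · funext x
      exact p.2.2.1 x
  · have := congrArg (fun r => r.1.1 j) q.2
    exact this
  · have := congrArg (fun r => r.1.2 x) q.2
    exact this
  · intro p; rfl
  · intro p; rfl

/-! ### Jacobi–Trudi numbers -/

lemma rw_count_cons {k l : ℕ} (w : Fin (k + 1) → Fin l) (i : Fin l) :
    Nat.card {j : Fin (k + 1) // w j = i} =
      (if i = w 0 then 1 else 0) + Nat.card {j : Fin k // w j.succ = i} := by
  rw [Nat.card_eq_fintype_card, Nat.card_eq_fintype_card, Fintype.card_subtype,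
    Fintype.card_subtype, Fin.card_filter_univ_succ]
  by_cases h : i = w 0
  · simp [h, add_comm]
  · simp [h, Ne.symm h]

lemma rwWords_succ (k l : ℕ) (c : Fin l → ℤ) :
    rwWords (k + 1) l c = ∑ a, rwWords k l (fun i => c i - if i = a then 1 else 0) := by
  unfold rwWords
  rw [← Nat.card_sigma]
  apply Nat.card_congr
  refine ⟨fun w => ⟨w.1 0, ⟨fun j => w.1 j.succ, fun i => ?_⟩⟩,
    fun p => ⟨Fin.cons p.1 p.2.1, fun i => ?_⟩, ?_, ?_⟩
  · have := w.2 i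
    rw [rw_count_cons] at this
    push_cast at this
    linarith
  · have := p.2.2 i
    rw [rw_count_cons]
    simp only [Fin.cons_zero, Fin.cons_succ]
    push_cast
    linarith
  · rintro ⟨w, hw⟩
    apply Subtype.ext
    exact Fin.cons_self_tail w
  · rintro ⟨a, w, hw⟩
    rfl

lemma rwWords_neg (k l : ℕ) (c : Fin l → ℤ) (i : Fin l) (hi : c i < 0) : rwWords k l c = 0 := by
  unfold rwWords
  have : IsEmpty {w : Fin k → Fin l // ∀ i, ((Nat.card {j : Fin k // w j = i} : ℕ) : ℤ) ≤ c i} := by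
    constructor
    rintro ⟨w, hw⟩
    have := hw i
    omega
  exact Nat.card_of_isEmpty

lemma rwWords_zero (l : ℕ) (c : Fin l → ℤ) :
    (rwWords 0 l c : ℤ) = ∏ i, if 0 ≤ c i then 1 else 0 := by
  by_cases h : ∀ i, 0 ≤ c i
  · rw [Finset.prod_congr rfl (fun i _ => if_pos (h i)), Finset.prod_const_one]
    have : rwWords 0 l c = 1 := by
      unfold rwWords
      rw [Nat.card_eq_one_iff_unique]
      refine ⟨⟨fun a b => Subtype.ext (Subsingleton.elim _ _)⟩, ⟨⟨Fin.elim0, fun i => ?_⟩⟩⟩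
      simpa using h i
    rw [this]; rfl
  · push Not at h
    obtain ⟨i, hi⟩ := h
    rw [rwWords_neg 0 l c i hi, Finset.prod_eq_zero (Finset.mem_univ i)]
    · rfl
    · rw [if_neg (not_le.2 hi)]

/-- The alternating sum of Jacobi–Trudi type. -/
def rwJT (k l : ℕ) (c : Fin l → ℤ) : ℤ :=
  ∑ σ : Equiv.Perm (Fin l), ((Equiv.Perm.sign σ : ℤˣ) : ℤ) *
    (rwWords k l (fun i => c i - ((i : ℕ) : ℤ) + ((σ i : ℕ) : ℤ)) : ℤ)

lemma rwJT_succ (k l : ℕ) (c : Fin l → ℤ) :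
    rwJT (k + 1) l c = ∑ a, rwJT k l (fun i => c i - if i = a then 1 else 0) := by
  unfold rwJT
  rw [Finset.sum_comm]
  refine Finset.sum_congr rfl fun σ _ => ?_
  rw [rwWords_succ, ← Finset.mul_sum, Nat.cast_sum]
  congr 1
  refine Finset.sum_congr rfl fun a _ => ?_
  congr 2
  funext i
  ring

lemma rwWords_perm (k l : ℕ) (c : Fin l → ℤ) (τ : Equiv.Perm (Fin l)) :
    rwWords k l (fun i => c (τ i)) = rwWords k l c := by
  unfold rwWords
  apply Nat.card_congr
  refine (Equiv.arrowCongr (Equiv.refl _) τ).subtypeEquiv ?_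
  intro w
  have h : ∀ i, Nat.card {j : Fin k // w j = i} = Nat.card {j : Fin k // τ (w j) = τ i} := by
    intro i
    apply Nat.card_congr
    exact (Equiv.refl _).subtypeEquiv (fun j => by simp)
  constructor
  · intro hw i
    have := hw (τ.symm i)
    rw [h] at this
    simpa using this
  · intro hw i
    have := hw (τ i)
    rw [h]
    simpa using this

lemma rwJT_row_eq (k l : ℕ) (c : Fin l → ℤ) (a b : Fin l) (hab : a ≠ b)
    (h : c a - ((a : ℕ) : ℤ) = c b - ((b : ℕ) : ℤ)) : rwJT k l c = 0 := by
  have h1 : rwJT k l c = - rwJT k l c := by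
    conv_lhs => unfold rwJT
    rw [← Equiv.sum_comp (Equiv.mulRight (Equiv.swap a b))]
    unfold rwJT
    rw [← Finset.sum_neg_distrib]
    refine Finset.sum_congr rfl fun σ _ => ?_
    have h2 : rwWords k l (fun i => c i - ((i : ℕ) : ℤ) +
          (((Equiv.mulRight (Equiv.swap a b)) σ i : ℕ) : ℤ)) =
        rwWords k l (fun i => c i - ((i : ℕ) : ℤ) + ((σ i : ℕ) : ℤ)) := by
      rw [← rwWords_perm k l (fun i => c i - ((i : ℕ) : ℤ) + ((σ i : ℕ) : ℤ)) (Equiv.swap a b)]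
      congr 1
      funext i
      have h3 : c i - ((i : ℕ) : ℤ) = c (Equiv.swap a b i) - ((Equiv.swap a b i : ℕ) : ℤ) := by
        by_cases hia : i = a
        · rw [hia, Equiv.swap_apply_left, h]
        · by_cases hib : i = b
          · rw [hib, Equiv.swap_apply_right, h]
          · rw [Equiv.swap_apply_of_ne_of_ne hia hib]
      rw [h3]
      rfl
    rw [h2]
    simp [Equiv.Perm.sign_mul, Equiv.Perm.sign_swap hab]
  linarith

lemma rwJT_neg (k l : ℕ) (c : Fin l → ℤ) (a : Fin l) (ha : (a : ℕ) + 1 = l) (h : c a < 0) :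
    rwJT k l c = 0 := by
  unfold rwJT
  refine Finset.sum_eq_zero fun σ _ => ?_
  rw [rwWords_neg k l _ a]
  · simp
  · have := (σ a).2
    omega

lemma rwJT_zero_one (l : ℕ) (c : Fin l → ℤ) (hpos : ∀ i : Fin l, (i : ℕ) = 0 → 0 ≤ c i)
    (h0 : ∀ i : Fin l, (i : ℕ) ≠ 0 → c i = 0) : rwJT 0 l c = 1 := by
  have h1 : rwJT 0 l c = (Matrix.of fun i j : Fin l =>
      if 0 ≤ c i - ((i : ℕ) : ℤ) + ((j : ℕ) : ℤ) then (1 : ℤ) else 0).det := by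
    rw [← Matrix.det_transpose, Matrix.det_apply]
    unfold rwJT
    refine Finset.sum_congr rfl fun σ _ => ?_
    rw [rwWords_zero, Units.smul_def, smul_eq_mul]
    rfl
  rw [h1, Matrix.det_of_isUpperTriangular]
  · refine Finset.prod_eq_one fun i _ => ?_
    rw [Matrix.of_apply, if_pos]
    by_cases hi : (i : ℕ) = 0
    · have := hpos i hi; omega
    · rw [h0 i hi]; omega
  · intro i j hij
    have hij' : (j : ℕ) < (i : ℕ) := hij
    rw [Matrix.of_apply, if_neg]
    rw [h0 i (by omega)]
    omega

lemma rwJT_zero_zero (l : ℕ) (c : Fin l → ℤ) (a b : Fin l) (ha : (a : ℕ) = 0) (hb : (b : ℕ) = 1)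
    (hca : 0 ≤ c a) (hcb : 1 ≤ c b) : rwJT 0 l c = 0 := by
  have h1 : rwJT 0 l c = (Matrix.of fun i j : Fin l =>
      if 0 ≤ c i - ((i : ℕ) : ℤ) + ((j : ℕ) : ℤ) then (1 : ℤ) else 0).det := by
    rw [← Matrix.det_transpose, Matrix.det_apply]
    unfold rwJT
    refine Finset.sum_congr rfl fun σ _ => ?_
    rw [rwWords_zero, Units.smul_def, smul_eq_mul]
    rfl
  rw [h1]
  apply Matrix.det_zero_of_row_eq (i := a) (j := b)
  · intro h; rw [h] at ha; omega
  · funext j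
    change (if _ then _ else _) = (if _ then _ else _)
    rw [if_pos (by omega), if_pos (by omega)]

/-! ### Removing the largest entry of a tableau -/

lemma rw_entry_le {μ : YoungDiagram} (Q : SYT μ) (i j : ℕ) : Q.entry i j ≤ μ.card := by
  by_cases h : (i, j) ∈ μ
  · have := Q.bijOn.mapsTo (show (i, j) ∈ (↑μ.cells : Set (ℕ × ℕ)) from h)
    simp only [Finset.coe_Icc, Set.mem_Icc] at this
    exact this.2
  · rw [Q.entry_eq_zero i j h]; exact Nat.zero_le _

lemma rw_entry_pos {μ : YoungDiagram} (Q : SYT μ) (i j : ℕ) (h : (i, j) ∈ μ) :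
    1 ≤ Q.entry i j := by
  have := Q.bijOn.mapsTo (show (i, j) ∈ (↑μ.cells : Set (ℕ × ℕ)) from h)
  simp only [Finset.coe_Icc, Set.mem_Icc] at this
  exact this.1

lemma rw_entry_inj {μ : YoungDiagram} (Q : SYT μ) {i j i' j' : ℕ} (h : (i, j) ∈ μ)
    (h' : (i', j') ∈ μ) (he : Q.entry i j = Q.entry i' j') : i = i' ∧ j = j' := by
  have := Q.bijOn.injOn (show (i, j) ∈ (↑μ.cells : Set (ℕ × ℕ)) from h)
    (show (i', j') ∈ (↑μ.cells : Set (ℕ × ℕ)) from h') he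
  exact Prod.mk.inj this

lemma rw_entry_surj {μ : YoungDiagram} (Q : SYT μ) (k : ℕ) (h1 : 1 ≤ k) (h2 : k ≤ μ.card) :
    ∃ i j, (i, j) ∈ μ ∧ Q.entry i j = k := by
  obtain ⟨⟨i, j⟩, h, h'⟩ := Q.bijOn.surjOn
    (show k ∈ (↑(Finset.Icc 1 μ.card) : Set ℕ) by simp [h1, h2])
  exact ⟨i, j, h, h'⟩

lemma rw_syt_ext {μ : YoungDiagram} (Q R : SYT μ) (h : ∀ i j, Q.entry i j = R.entry i j) :
    Q = R := by
  cases Q; cases R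
  congr
  funext i j
  exact h i j

instance rw_syt_finite (μ : YoungDiagram) : Finite (SYT μ) := by
  let F : SYT μ → (μ.cells → Fin (μ.card + 1)) := fun Q p =>
    ⟨Q.entry p.1.1 p.1.2, Nat.lt_succ_of_le (rw_entry_le Q _ _)⟩
  apply Finite.of_injective F
  intro Q R h
  apply rw_syt_ext
  intro i j
  by_cases hm : (i, j) ∈ μ
  · exact congrArg Fin.val (congrFun h ⟨(i, j), hm⟩)
  · rw [Q.entry_eq_zero i j hm, R.entry_eq_zero i j hm]

/-- Removal of the corner at the end of row `i`. -/
def rwErase (μ : YoungDiagram) (i : ℕ) (h : μ.rowLen (i + 1) < μ.rowLen i) : YoungDiagram where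
  cells := μ.cells.erase (i, μ.rowLen i - 1)
  isLowerSet := by
    rintro ⟨a1, a2⟩ ⟨b1, b2⟩ hba ha
    have hba1 : b1 ≤ a1 := hba.1
    have hba2 : b2 ≤ a2 := hba.2
    rw [Finset.mem_coe, Finset.mem_erase] at ha ⊢
    have ham : (a1, a2) ∈ μ := ha.2
    refine ⟨?_, μ.isLowerSet hba ha.2⟩
    intro hb
    obtain ⟨rfl, rfl⟩ := Prod.mk.inj hb
    have h2 := YoungDiagram.mem_iff_lt_rowLen.1 ham
    rcases Nat.lt_or_ge b1 a1 with h3 | h3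
    · have := μ.rowLen_anti _ _ (show b1 + 1 ≤ a1 from h3)
      omega
    · have h4 : a1 = b1 := by omega
      subst h4
      apply ha.1
      rw [Prod.mk.injEq]
      omega

lemma rw_mem_erase {μ : YoungDiagram} {i : ℕ} {h : μ.rowLen (i + 1) < μ.rowLen i} {a b : ℕ} :
    (a, b) ∈ rwErase μ i h ↔ ¬ (a = i ∧ b = μ.rowLen i - 1) ∧ (a, b) ∈ μ := by
  change (a, b) ∈ μ.cells.erase (i, μ.rowLen i - 1) ↔ _
  rw [Finset.mem_erase, Ne, Prod.mk.injEq]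
  rfl

lemma rw_corner_mem {μ : YoungDiagram} {i : ℕ} (h : μ.rowLen (i + 1) < μ.rowLen i) :
    (i, μ.rowLen i - 1) ∈ μ := by
  rw [YoungDiagram.mem_iff_lt_rowLen]; omega

lemma rw_erase_card {μ : YoungDiagram} {i : ℕ} (h : μ.rowLen (i + 1) < μ.rowLen i) :
    (rwErase μ i h).card + 1 = μ.card := by
  exact Finset.card_erase_add_one (rw_corner_mem h)

lemma rw_erase_rowLen {μ : YoungDiagram} {i : ℕ} (h : μ.rowLen (i + 1) < μ.rowLen i) (a : ℕ) :
    (rwErase μ i h).rowLen a = μ.rowLen a - if a = i then 1 else 0 := by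
  have key : ∀ b, b < (rwErase μ i h).rowLen a ↔ b < μ.rowLen a - if a = i then 1 else 0 := by
    intro b
    rw [← YoungDiagram.mem_iff_lt_rowLen, rw_mem_erase, YoungDiagram.mem_iff_lt_rowLen]
    split_ifs with hai
    · subst hai; omega
    · simp [hai]
  have h1 := key ((rwErase μ i h).rowLen a)
  have h2 := key (μ.rowLen a - if a = i then 1 else 0)
  omega

/-- The numbers `1,…,t` are in the first row. -/
def rwFR {μ : YoungDiagram} (Q : SYT μ) (t : ℕ) : Prop :=
  ∀ k, 1 ≤ k → k ≤ t → ∃ j, (0, j) ∈ μ ∧ Q.entry 0 j = k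

lemma rw_fSYTRow (μ : YoungDiagram) (t : ℕ) :
    fSYTRow μ t = Nat.card {Q : SYT μ // rwFR Q t} := rfl

/-- Restriction of a tableau to the complement of a corner containing the largest entry. -/
def rwRestrict {μ : YoungDiagram} {i : ℕ} (h : μ.rowLen (i + 1) < μ.rowLen i) (Q : SYT μ)
    (hQ : Q.entry i (μ.rowLen i - 1) = μ.card) : SYT (rwErase μ i h) where
  entry a b := if (a, b) ∈ rwErase μ i h then Q.entry a b else 0
  entry_eq_zero a b hab := if_neg hab
  row_strict a b1 b2 hb hab := by
    have h1 : (a, b1) ∈ rwErase μ i h :=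
      (rwErase μ i h).isLowerSet (show (a, b1) ≤ (a, b2) from ⟨le_rfl, hb.le⟩) hab
    rw [if_pos h1, if_pos hab]
    exact Q.row_strict a b1 b2 hb (rw_mem_erase.1 hab).2
  col_strict a1 a2 b ha hab := by
    have h1 : (a1, b) ∈ rwErase μ i h :=
      (rwErase μ i h).isLowerSet (show (a1, b) ≤ (a2, b) from ⟨ha.le, le_rfl⟩) hab
    rw [if_pos h1, if_pos hab]
    exact Q.col_strict a1 a2 b ha (rw_mem_erase.1 hab).2
  bijOn := by
    have hcard := rw_erase_card h
    refine ⟨?_, ?_, ?_⟩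
    · rintro ⟨a, b⟩ hab
      have hab' : (a, b) ∈ rwErase μ i h := hab
      have hm := rw_mem_erase.1 hab'
      simp only [if_pos hab', Finset.coe_Icc, Set.mem_Icc]
      refine ⟨rw_entry_pos Q a b hm.2, ?_⟩
      have h1 := rw_entry_le Q a b
      have h2 : Q.entry a b ≠ μ.card := by
        intro h3
        rw [← hQ] at h3
        exact hm.1 (rw_entry_inj Q hm.2 (rw_corner_mem h) h3)
      omega
    · rintro ⟨a, b⟩ hab ⟨a', b'⟩ hab' heq
      have h1 : (a, b) ∈ rwErase μ i h := hab
      have h1' : (a', b') ∈ rwErase μ i h := hab'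
      simp only [if_pos h1, if_pos h1'] at heq
      exact Prod.ext_iff.2 (rw_entry_inj Q (rw_mem_erase.1 h1).2 (rw_mem_erase.1 h1').2 heq)
    · intro k hk
      simp only [Finset.coe_Icc, Set.mem_Icc] at hk
      obtain ⟨a, b, hab, he⟩ := rw_entry_surj Q k hk.1 (by omega)
      have h1 : (a, b) ∈ rwErase μ i h := by
        rw [rw_mem_erase]
        refine ⟨?_, hab⟩
        rintro ⟨rfl, rfl⟩
        omega
      refine ⟨(a, b), h1, ?_⟩
      simp only [if_pos h1]
      exact he

/-- Extension of a tableau by a new largest entry at a corner. -/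
def rwExtend {μ : YoungDiagram} {i : ℕ} (h : μ.rowLen (i + 1) < μ.rowLen i)
    (Q : SYT (rwErase μ i h)) : SYT μ where
  entry a b := if a = i ∧ b = μ.rowLen i - 1 then μ.card else Q.entry a b
  entry_eq_zero a b hab := by
    rw [if_neg, Q.entry_eq_zero]
    · exact fun h1 => hab (rw_mem_erase.1 h1).2
    · rintro ⟨rfl, rfl⟩
      exact hab (rw_corner_mem h)
  row_strict a b1 b2 hb hab := by
    have hcard := rw_erase_card h
    by_cases h2 : a = i ∧ b2 = μ.rowLen i - 1
    · rw [if_pos h2, if_neg (by omega)]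
      have := rw_entry_le Q a b1
      omega
    · have h3 : (a, b2) ∈ rwErase μ i h := rw_mem_erase.2 ⟨h2, hab⟩
      have h1 : (a, b1) ∈ rwErase μ i h :=
        (rwErase μ i h).isLowerSet (show (a, b1) ≤ (a, b2) from ⟨le_rfl, hb.le⟩) h3
      rw [if_neg h2, if_neg (rw_mem_erase.1 h1).1]
      exact Q.row_strict a b1 b2 hb h3
  col_strict a1 a2 b ha hab := by
    have hcard := rw_erase_card h
    by_cases h2 : a2 = i ∧ b = μ.rowLen i - 1
    · rw [if_pos h2, if_neg (by omega)]
      have := rw_entry_le Q a1 b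
      omega
    · have h3 : (a2, b) ∈ rwErase μ i h := rw_mem_erase.2 ⟨h2, hab⟩
      have h1 : (a1, b) ∈ rwErase μ i h :=
        (rwErase μ i h).isLowerSet (show (a1, b) ≤ (a2, b) from ⟨ha.le, le_rfl⟩) h3
      rw [if_neg h2, if_neg (rw_mem_erase.1 h1).1]
      exact Q.col_strict a1 a2 b ha h3
  bijOn := by
    have hcard := rw_erase_card h
    refine ⟨?_, ?_, ?_⟩
    · rintro ⟨a, b⟩ hab
      have hab' : (a, b) ∈ μ := hab
      simp only [Finset.coe_Icc, Set.mem_Icc]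
      split_ifs with h1
      · omega
      · have h2 := rw_entry_pos Q a b (rw_mem_erase.2 ⟨h1, hab'⟩)
        have h3 := rw_entry_le Q a b
        omega
    · rintro ⟨a, b⟩ hab ⟨a', b'⟩ hab' heq
      simp only at heq
      have hl := rw_entry_le Q a b
      have hl' := rw_entry_le Q a' b'
      rw [Prod.mk.injEq]
      split_ifs at heq with h1 h2 h2
      · omega
      · omega
      · omega
      · exact rw_entry_inj Q (rw_mem_erase.2 ⟨h1, hab⟩) (rw_mem_erase.2 ⟨h2, hab'⟩) heq
    · intro k hk
      simp only [Finset.coe_Icc, Set.mem_Icc] at hk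
      by_cases hkc : k = μ.card
      · refine ⟨(i, μ.rowLen i - 1), rw_corner_mem h, ?_⟩
        simp [hkc]
      · obtain ⟨a, b, hab, he⟩ := rw_entry_surj Q k hk.1 (by omega)
        refine ⟨(a, b), (rw_mem_erase.1 hab).2, ?_⟩
        simp only [if_neg (rw_mem_erase.1 hab).1]
        exact he

lemma rw_card_fiber {μ : YoungDiagram} {i : ℕ} (h : μ.rowLen (i + 1) < μ.rowLen i) (m : ℕ)
    (hm : m < μ.card) :
    Nat.card {Q : SYT μ // rwFR Q m ∧ Q.entry i (μ.rowLen i - 1) = μ.card} =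
      fSYTRow (rwErase μ i h) m := by
  rw [rw_fSYTRow]
  apply Nat.card_congr
  refine ⟨fun Q => ⟨rwRestrict h Q.1 Q.2.2, ?_⟩, fun Q => ⟨rwExtend h Q.1, ?_, ?_⟩, ?_, ?_⟩
  · intro k hk1 hk2
    obtain ⟨j, hj, he⟩ := Q.2.1 k hk1 hk2
    have h1 : (0, j) ∈ rwErase μ i h := by
      rw [rw_mem_erase]
      refine ⟨?_, hj⟩
      rintro ⟨h2, rfl⟩
      subst h2
      have := Q.2.2
      omega
    refine ⟨j, h1, ?_⟩
    change (if (0, j) ∈ rwErase μ i h then Q.1.entry 0 j else 0) = k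
    rw [if_pos h1, he]
  · intro k hk1 hk2
    obtain ⟨j, hj, he⟩ := Q.2 k hk1 hk2
    refine ⟨j, (rw_mem_erase.1 hj).2, ?_⟩
    change (if 0 = i ∧ j = μ.rowLen i - 1 then μ.card else Q.1.entry 0 j) = k
    rw [if_neg (rw_mem_erase.1 hj).1, he]
  · change (if i = i ∧ μ.rowLen i - 1 = μ.rowLen i - 1 then μ.card else _) = μ.card
    simp
  · rintro ⟨Q, hQ1, hQ2⟩
    apply Subtype.ext
    apply rw_syt_ext
    intro a b
    change (if a = i ∧ b = μ.rowLen i - 1 then μ.card else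
      if (a, b) ∈ rwErase μ i h then Q.entry a b else 0) = Q.entry a b
    split_ifs with h1 h2
    · rw [h1.1, h1.2, hQ2]
    · rfl
    · rw [Q.entry_eq_zero]
      exact fun h3 => h2 (rw_mem_erase.2 ⟨h1, h3⟩)
  · rintro ⟨Q, hQ⟩
    apply Subtype.ext
    apply rw_syt_ext
    intro a b
    change (if (a, b) ∈ rwErase μ i h then
      if a = i ∧ b = μ.rowLen i - 1 then μ.card else Q.entry a b else 0) = Q.entry a b
    split_ifs with h1 h2
    · exact absurd h2 (rw_mem_erase.1 h1).1
    · rfl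
    · rw [Q.entry_eq_zero _ _ h1]

lemma rw_max_corner {μ : YoungDiagram} (Q : SYT μ) (hμ : 0 < μ.card) :
    ∃ i, μ.rowLen (i + 1) < μ.rowLen i ∧ Q.entry i (μ.rowLen i - 1) = μ.card := by
  obtain ⟨i, j, hij, he⟩ := rw_entry_surj Q μ.card hμ le_rfl
  have h1 := YoungDiagram.mem_iff_lt_rowLen.1 hij
  have h2 : ¬ (i, j + 1) ∈ μ := by
    intro h
    have := Q.row_strict i j (j + 1) (by omega) h
    have := rw_entry_le Q i (j + 1)
    omega
  have h3 : ¬ (i + 1, j) ∈ μ := by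
    intro h
    have := Q.col_strict i (i + 1) j (by omega) h
    have := rw_entry_le Q (i + 1) j
    omega
  rw [YoungDiagram.mem_iff_lt_rowLen] at h2 h3
  refine ⟨i, by omega, ?_⟩
  rw [show μ.rowLen i - 1 = j by omega, he]

lemma rw_branch (μ : YoungDiagram) (l m : ℕ) (hl : μ.rowLen l = 0) (hm : m < μ.card) :
    fSYTRow μ m = ∑ i : Fin l, if h : μ.rowLen ((i : ℕ) + 1) < μ.rowLen i then
      fSYTRow (rwErase μ i h) m else 0 := by
  have hpos : 0 < μ.card := by omega
  have hex : ∀ Q : SYT μ, ∃ i : Fin l, μ.rowLen ((i : ℕ) + 1) < μ.rowLen i ∧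
      Q.entry i (μ.rowLen i - 1) = μ.card := by
    intro Q
    obtain ⟨i, h1, h2⟩ := rw_max_corner Q hpos
    have : i < l := by
      by_contra hcon
      have := μ.rowLen_anti _ _ (show l ≤ i by omega)
      omega
    exact ⟨⟨i, this⟩, h1, h2⟩
  choose r hr1 hr2 using hex
  have hr : ∀ (Q : SYT μ) (i : Fin l), r Q = i ↔ Q.entry i (μ.rowLen i - 1) = μ.card := by
    intro Q i
    constructor
    · rintro rfl; exact hr2 Q
    · intro h
      have hmem : ((i : ℕ), μ.rowLen i - 1) ∈ μ := by
        by_contra hcon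
        have := Q.entry_eq_zero _ _ hcon
        omega
      exact Fin.ext (rw_entry_inj Q (rw_corner_mem (hr1 Q)) hmem ((hr2 Q).trans h.symm)).1
  rw [rw_fSYTRow, ← Nat.card_congr (Equiv.sigmaFiberEquiv (fun Q : {Q : SYT μ // rwFR Q m} => r Q.1)),
    Nat.card_sigma]
  refine Finset.sum_congr rfl fun i _ => ?_
  split_ifs with h
  · rw [← rw_card_fiber h m hm]
    apply Nat.card_congr
    refine (Equiv.subtypeSubtypeEquivSubtypeInter (fun Q : SYT μ => rwFR Q m)
      (fun Q => r Q = i)).trans ?_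
    exact (Equiv.refl _).subtypeEquiv (fun Q => by
      rw [hr]; rfl)
  · have : IsEmpty {x : {Q : SYT μ // rwFR Q m} // r x.1 = i} := by
      constructor
      rintro ⟨Q, rfl⟩
      exact h (hr1 Q.1)
    exact Nat.card_of_isEmpty

/-- The tableau of a one-row shape. -/
def rwRowSYT (μ : YoungDiagram) (h : μ.rowLen 1 = 0) : SYT μ where
  entry i j := if (i, j) ∈ μ then j + 1 else 0
  entry_eq_zero i j hij := if_neg hij
  row_strict i j1 j2 hj hm := by
    rw [if_pos hm]
    split_ifs <;> omega
  col_strict i1 i2 j hi hm := by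
    have := μ.rowLen_anti _ _ (show 1 ≤ i2 by omega)
    rw [YoungDiagram.mem_iff_lt_rowLen] at hm
    omega
  bijOn := by
    have h0 : ∀ i j, (i, j) ∈ μ → i = 0 := by
      intro i j hm
      by_contra hcon
      have := μ.rowLen_anti _ _ (show 1 ≤ i by omega)
      rw [YoungDiagram.mem_iff_lt_rowLen] at hm
      omega
    have hmaps : Set.MapsTo (fun p : ℕ × ℕ => if (p.1, p.2) ∈ μ then p.2 + 1 else 0)
        ↑μ.cells ↑(Finset.Icc 1 (μ.rowLen 0)) := by
      rintro ⟨i, j⟩ hm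
      have hm' : (i, j) ∈ μ := hm
      have := h0 i j hm
      subst this
      simp only [if_pos hm', Finset.coe_Icc, Set.mem_Icc]
      rw [YoungDiagram.mem_iff_lt_rowLen] at hm'
      omega
    have hinj : Set.InjOn (fun p : ℕ × ℕ => if (p.1, p.2) ∈ μ then p.2 + 1 else 0)
        ↑μ.cells := by
      rintro ⟨i, j⟩ hm ⟨i', j'⟩ hm' heq
      have h1 : (i, j) ∈ μ := hm
      have h2 : (i', j') ∈ μ := hm'
      simp only [if_pos h1, if_pos h2] at heq
      rw [Prod.mk.injEq, h0 _ _ h1, h0 _ _ h2]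
      omega
    have hsurj : Set.SurjOn (fun p : ℕ × ℕ => if (p.1, p.2) ∈ μ then p.2 + 1 else 0)
        ↑μ.cells ↑(Finset.Icc 1 (μ.rowLen 0)) := by
      intro k hk
      simp only [Finset.coe_Icc, Set.mem_Icc] at hk
      have : (0, k - 1) ∈ μ := by rw [YoungDiagram.mem_iff_lt_rowLen]; omega
      refine ⟨(0, k - 1), this, ?_⟩
      simp only [if_pos this]
      omega
    have hc : μ.card = μ.rowLen 0 := by
      have := Finset.card_nbij _ hmaps hinj hsurj
      simpa using this
    rw [hc]
    exact ⟨hmaps, hinj, hsurj⟩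

lemma rw_base_one (μ : YoungDiagram) (h : μ.rowLen 1 = 0) : fSYTRow μ μ.card = 1 := by
  have h0 : ∀ i j, (i, j) ∈ μ → i = 0 := by
    intro i j hm
    by_contra hcon
    have := μ.rowLen_anti _ _ (show 1 ≤ i by omega)
    rw [YoungDiagram.mem_iff_lt_rowLen] at hm
    omega
  rw [rw_fSYTRow, Nat.card_eq_one_iff_unique]
  have key : ∀ Q : SYT μ, ∀ j, (0, j) ∈ μ → j + 1 ≤ Q.entry 0 j := by
    intro Q j
    induction j with
    | zero => intro hj; exact rw_entry_pos Q 0 0 hj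
    | succ j ih =>
      intro hj
      have h1 := Q.row_strict 0 j (j + 1) (by omega) hj
      have := ih (μ.isLowerSet (show (0, j) ≤ (0, j + 1) from ⟨le_rfl, by simp⟩) hj)
      omega
  have hcard : μ.card = μ.rowLen 0 := by
    have h1 := (rwRowSYT μ h).bijOn
    rcases Nat.eq_zero_or_pos μ.card with h2 | h2
    · rw [h2]
      by_contra hcon
      have h3 : (0, 0) ∈ μ := by rw [YoungDiagram.mem_iff_lt_rowLen]; omega
      have := Finset.card_pos.2 ⟨(0, 0), h3⟩
      have : 0 < μ.card := this
      omega
    · obtain ⟨i, j, hij, he⟩ := rw_entry_surj (rwRowSYT μ h) μ.card h2 le_rfl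
      change (if (i, j) ∈ μ then j + 1 else 0) = μ.card at he
      rw [if_pos hij] at he
      have := h0 i j hij
      subst this
      have h4 : (0, μ.rowLen 0 - 1) ∈ μ := by
        rw [YoungDiagram.mem_iff_lt_rowLen] at hij ⊢
        omega
      have h5 := rw_entry_le (rwRowSYT μ h) 0 (μ.rowLen 0 - 1)
      change (if (0, μ.rowLen 0 - 1) ∈ μ then μ.rowLen 0 - 1 + 1 else 0) ≤ _ at h5
      rw [if_pos h4] at h5
      rw [YoungDiagram.mem_iff_lt_rowLen] at hij
      omega
  have key2 : ∀ Q : SYT μ, ∀ d j, (0, j) ∈ μ → j + 1 + d = μ.card → Q.entry 0 j ≤ j + 1 := by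
    intro Q d
    induction d with
    | zero =>
      intro j hj hd
      have := rw_entry_le Q 0 j
      omega
    | succ d ih =>
      intro j hj hd
      have hj1 : (0, j + 1) ∈ μ := by rw [YoungDiagram.mem_iff_lt_rowLen]; omega
      have h1 := Q.row_strict 0 j (j + 1) (by omega) hj1
      have := ih (j + 1) hj1 (by omega)
      omega
  refine ⟨⟨?_⟩, ⟨⟨rwRowSYT μ h, ?_⟩⟩⟩
  · rintro ⟨Q, hQ⟩ ⟨R, hR⟩
    apply Subtype.ext
    apply rw_syt_ext
    intro i j
    by_cases hm : (i, j) ∈ μ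
    · have := h0 i j hm
      subst this
      have hlt := YoungDiagram.mem_iff_lt_rowLen.1 hm
      have h1 := key Q j hm
      have h2 := key R j hm
      have h3 := key2 Q (μ.card - (j + 1)) j hm (by omega)
      have h4 := key2 R (μ.card - (j + 1)) j hm (by omega)
      simp only
      omega
    · simp only
      rw [Q.entry_eq_zero i j hm, R.entry_eq_zero i j hm]
  · intro k hk1 hk2
    have hm : (0, k - 1) ∈ μ := by rw [YoungDiagram.mem_iff_lt_rowLen]; omega
    refine ⟨k - 1, hm, ?_⟩
    change (if (0, k - 1) ∈ μ then k - 1 + 1 else 0) = k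
    rw [if_pos hm]
    omega

lemma rw_base_zero (μ : YoungDiagram) (h : μ.rowLen 1 ≠ 0) : fSYTRow μ μ.card = 0 := by
  rw [rw_fSYTRow]
  have : IsEmpty {Q : SYT μ // rwFR Q μ.card} := by
    constructor
    rintro ⟨Q, hQ⟩
    have hm : (1, 0) ∈ μ := by rw [YoungDiagram.mem_iff_lt_rowLen]; omega
    obtain ⟨j, hj, he⟩ := hQ (Q.entry 1 0) (rw_entry_pos Q 1 0 hm) (rw_entry_le Q 1 0)
    have := (rw_entry_inj Q hj hm he).1
    omega
  exact Nat.card_of_isEmpty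

lemma rw_JT_eq (k : ℕ) : ∀ (m l : ℕ) (μ : YoungDiagram), μ.card = m + k → μ.rowLen l = 0 →
    rwJT k l (fun i : Fin l => ((μ.rowLen (i : ℕ) : ℕ) : ℤ)) = (fSYTRow μ m : ℤ) := by
  induction k with
  | zero =>
    intro m l μ hc hl
    have hm : m = μ.card := by omega
    subst hm
    by_cases h : μ.rowLen 1 = 0
    · rw [rw_base_one μ h, rwJT_zero_one]
      · rfl
      · intro i _; positivity
      · intro i hi
        have := μ.rowLen_anti _ _ (show 1 ≤ (i : ℕ) by omega)
        have h3 : μ.rowLen i = 0 := by omega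
        rw [h3]; rfl
    · rw [rw_base_zero μ h]
      have hl2 : 1 < l := by
        by_contra hcon
        have := μ.rowLen_anti _ _ (show l ≤ 1 by omega)
        omega
      rw [rwJT_zero_zero l _ ⟨0, by omega⟩ ⟨1, hl2⟩ rfl rfl]
      · rfl
      · positivity
      · change 1 ≤ ((μ.rowLen 1 : ℕ) : ℤ)
        omega
  | succ k ih =>
    intro m l μ hc hl
    rw [rwJT_succ, rw_branch μ l m hl (by omega), Nat.cast_sum]
    refine Finset.sum_congr rfl fun a _ => ?_
    split_ifs with h
    · rw [← ih m l (rwErase μ a h)]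
      · congr 1
        funext i
        rw [rw_erase_rowLen]
        by_cases hia : i = a
        · subst hia
          simp only [if_true]
          omega
        · have : ¬ ((i : ℕ) = (a : ℕ)) := fun h => hia (Fin.ext h)
          simp [hia, this]
      · have := rw_erase_card h
        omega
      · rw [rw_erase_rowLen, hl]; simp
    · have hanti := μ.rowLen_anti _ _ (show (a : ℕ) ≤ (a : ℕ) + 1 by omega)
      have ha := a.2
      rcases Nat.lt_or_ge ((a : ℕ) + 1) l with h1 | h1
      · rw [rwJT_row_eq k l _ a ⟨(a : ℕ) + 1, h1⟩]
        · rfl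
        · intro h2
          have := congrArg Fin.val h2
          simp at this
        · have h3 : ¬ ((⟨(a : ℕ) + 1, h1⟩ : Fin l) = a) := by
            intro h2
            have := congrArg Fin.val h2
            simp at this
          have h4 : ((⟨(a : ℕ) + 1, h1⟩ : Fin l) : ℕ) = (a : ℕ) + 1 := rfl
          simp only [h3, if_true, if_false]
          push_cast
          omega
      · have h2 : (a : ℕ) + 1 = l := by omega
        rw [rwJT_neg k l _ a h2]
        · rfl
        · rw [h2] at h
          simp only [if_true]
          omega

/-! ### The alternating sum over tableaux -/

lemma rw_FR_iff {μ : YoungDiagram} (Q : SYT μ) (j : ℕ) (hj : j ≤ μ.card) :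
    rwFR Q j ↔ j ≤ (insert μ.card Q.des).min' (Finset.insert_nonempty μ.card Q.des) := by
  constructor
  · intro h
    apply Finset.le_min'
    intro y hy
    rcases Finset.mem_insert.1 hy with rfl | hy
    · exact hj
    · unfold SYT.des at hy
      rw [Finset.mem_filter, Finset.mem_Icc] at hy
      obtain ⟨hy1, p1, hp1, p2, hp2, he1, he2, hlt⟩ := hy
      by_contra hcon
      obtain ⟨b, hb, hbe⟩ := h (y + 1) (by omega) (by omega)
      have := (rw_entry_inj Q hb hp2 (hbe.trans he2.symm)).1
      omega
  · intro h k
    induction k with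
    | zero => intro h0; omega
    | succ k ih =>
      intro _ hk
      obtain ⟨a, b, hab, he⟩ := rw_entry_surj Q (k + 1) (by omega) (by omega)
      rcases Nat.eq_zero_or_pos a with ha | ha
      · subst ha; exact ⟨b, hab, he⟩
      · exfalso
        rcases Nat.eq_zero_or_pos k with hk0 | hk0
        · have h1 := Q.col_strict 0 a b ha hab
          have h2 := rw_entry_pos Q 0 b
            (μ.isLowerSet (show (0, b) ≤ (a, b) from ⟨ha.le, le_rfl⟩) hab)
          omega
        · obtain ⟨b', hb', he'⟩ := ih (by omega) (by omega)
          have hdes : k ∈ Q.des := by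
            unfold SYT.des
            rw [Finset.mem_filter, Finset.mem_Icc]
            exact ⟨⟨by omega, by omega⟩, (0, b'), hb', (a, b), hab, he', he, ha⟩
          have := Finset.min'_le (insert μ.card Q.des) k (Finset.mem_insert_of_mem hdes)
          omega

lemma rw_alt_sum (n : ℕ) (μ : YoungDiagram) (hμ : μ.card = n) :
    ∑ j ∈ Finset.range (n + 1), (-1 : ℤ) ^ j * (fSYTRow μ j : ℤ) =
      (Nat.card {Q : SYT μ //
          Even ((insert n Q.des).min' (Finset.insert_nonempty n Q.des))} : ℤ) := by
  subst hμ
  have : Fintype (SYT μ) := Fintype.ofFinite _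
  have h1 : ∀ j, (fSYTRow μ j : ℤ) = ∑ Q : SYT μ, if rwFR Q j then 1 else 0 := by
    intro j
    rw [rw_fSYTRow, Nat.card_eq_fintype_card, Fintype.card_subtype, Finset.card_filter]
    push_cast
    rfl
  rw [Nat.card_eq_fintype_card, Fintype.card_subtype, Finset.card_filter]
  push_cast
  simp only [h1, Finset.mul_sum]
  rw [Finset.sum_comm]
  refine Finset.sum_congr rfl fun Q _ => ?_
  set M := (insert μ.card Q.des).min' (Finset.insert_nonempty μ.card Q.des) with hM
  have hMle : M ≤ μ.card := Finset.min'_le _ _ (Finset.mem_insert_self _ _)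
  have h2 : ∑ j ∈ Finset.range (μ.card + 1), (-1 : ℤ) ^ j * (if rwFR Q j then 1 else 0) =
      ∑ j ∈ Finset.range (M + 1), (-1 : ℤ) ^ j := by
    rw [← Finset.sum_subset (Finset.range_subset_range.2 (show M + 1 ≤ μ.card + 1 by omega))]
    · refine Finset.sum_congr rfl fun j hj => ?_
      rw [Finset.mem_range] at hj
      rw [if_pos ((rw_FR_iff Q j (by omega)).2 (by omega)), mul_one]
    · intro j hj1 hj2
      rw [Finset.mem_range] at hj1 hj2
      rw [if_neg, mul_zero]
      intro h3
      have := (rw_FR_iff Q j (by omega)).1 h3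
      omega
  rw [h2, neg_one_geom_sum]
  by_cases h3 : Even M
  · rw [if_neg, if_pos h3]
    rw [Nat.even_add_one]; simpa using h3
  · rw [if_pos, if_neg h3]
    rw [Nat.even_add_one]; exact h3

/-! ### The Euler characteristic of chains -/

lemma rw_euler {X : Type*} [PartialOrder X] [OrderBot X] [Fintype X] (ε : X → ℤ)
    (hbot : ε ⊥ = 1)
    (hε : ∀ w : X, w ≠ ⊥ → ∑ v ∈ Finset.univ.filter (fun v => v ≤ w), ε v = 0) (s : Finset X) :
    ⊥ ∉ s → (∀ w ∈ s, ∀ v, v ≤ w → v ≠ ⊥ → v ∈ s) →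
    ∑ D ∈ s.powerset, (if IsChain (· ≤ ·) (D : Set X) then (-1 : ℤ) ^ D.card else 0) =
      1 + ∑ w ∈ s, ε w := by
  induction s using Finset.strongInduction with
  | H s ih =>
  intro hs hlow
  rcases s.eq_empty_or_nonempty with rfl | hne
  · simp
  obtain ⟨w, hw, hmax⟩ := s.exists_maximal hne
  have hw0 : w ≠ ⊥ := fun h => hs (h ▸ hw)
  have ih1 := ih (s.erase w) (Finset.erase_ssubset hw) (fun h => hs (Finset.mem_of_mem_erase h))
    (by
      intro x hx v hv hv0
      rw [Finset.mem_erase] at hx ⊢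
      refine ⟨?_, hlow x hx.2 v hv hv0⟩
      rintro rfl
      exact hx.1 (le_antisymm (hmax hx.2 hv) hv))
  have ih2 := ih (s.filter (fun v => v < w))
    (by
      refine Finset.ssubset_iff_subset_ne.2 ⟨Finset.filter_subset _ _, ?_⟩
      intro h
      rw [← h, Finset.mem_filter] at hw
      exact lt_irrefl _ hw.2)
    (fun h => hs (Finset.mem_filter.1 h).1)
    (by
      intro x hx v hv hv0
      rw [Finset.mem_filter] at hx ⊢
      exact ⟨hlow x hx.1 v hv hv0, lt_of_le_of_lt hv hx.2⟩)
  have hsum := hε w hw0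
  have hset : Finset.univ.filter (fun v => v ≤ w) =
      insert ⊥ (insert w (s.filter (fun v => v < w))) := by
    ext v
    simp only [Finset.mem_filter, Finset.mem_univ, true_and, Finset.mem_insert]
    constructor
    · intro hv
      by_cases h0 : v = ⊥
      · exact Or.inl h0
      · rcases hv.eq_or_lt with h1 | h1
        · exact Or.inr (Or.inl h1)
        · exact Or.inr (Or.inr ⟨hlow w hw v hv h0, h1⟩)
    · rintro (rfl | rfl | h)
      · exact bot_le
      · exact le_rfl
      · exact h.2.le
  rw [hset, Finset.sum_insert, Finset.sum_insert, hbot] at hsum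
  rotate_left
  · simp
  · simp [hs, hw0.symm]
  have hsplit : s = insert w (s.erase w) := (Finset.insert_erase hw).symm
  conv_lhs => rw [hsplit]
  rw [Finset.sum_powerset_insert (Finset.notMem_erase w s), ih1]
  have h2 : ∑ t ∈ (s.erase w).powerset,
      (if IsChain (· ≤ ·) ((insert w t : Finset X) : Set X) then
        (-1 : ℤ) ^ (insert w t).card else 0) =
      - ∑ D ∈ (s.filter (fun v => v < w)).powerset,
        (if IsChain (· ≤ ·) (D : Set X) then (-1 : ℤ) ^ D.card else 0) := by
    rw [← Finset.sum_neg_distrib]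
    symm
    have hsub : (s.filter (fun v => v < w)).powerset ⊆ (s.erase w).powerset := by
      apply Finset.powerset_mono.2
      intro v hv
      rw [Finset.mem_filter] at hv
      exact Finset.mem_erase.2 ⟨hv.2.ne, hv.1⟩
    rw [← Finset.sum_subset hsub]
    · refine Finset.sum_congr rfl fun t ht => ?_
      rw [Finset.mem_powerset] at ht
      have hwt : w ∉ t := fun h => lt_irrefl _ (Finset.mem_filter.1 (ht h)).2
      have hiff : IsChain (· ≤ ·) ((insert w t : Finset X) : Set X) ↔
          IsChain (· ≤ ·) (t : Set X) := by
        rw [Finset.coe_insert]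
        constructor
        · intro h; exact h.mono (Set.subset_insert _ _)
        · intro h
          exact h.insert (fun b hb _ => Or.inr (Finset.mem_filter.1 (ht hb)).2.le)
      rw [Finset.card_insert_of_notMem hwt, pow_succ]
      by_cases hc : IsChain (· ≤ ·) (t : Set X)
      · rw [if_pos hc, if_pos (hiff.2 hc)]; ring
      · rw [if_neg hc, if_neg (fun h => hc (hiff.1 h))]; ring
    · intro t ht hnt
      rw [if_neg]
      intro hc
      apply hnt
      rw [Finset.mem_powerset] at ht ⊢
      intro v hv
      have hv' := Finset.mem_erase.1 (ht hv)
      rw [Finset.mem_filter]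
      refine ⟨hv'.2, lt_of_le_of_ne ?_ hv'.1⟩
      rcases hc (show v ∈ _ by simp [hv]) (show w ∈ _ by simp) hv'.1 with h | h
      · exact h
      · exact hmax hv'.2 h
  rw [h2, ih2, ← Finset.add_sum_erase s ε hw]
  linarith

/-! ### Injective words -/

instance rw_word_fintype (n : ℕ) : Fintype (InjWord n) :=
  inferInstanceAs (Fintype {l : List (Fin n) // l.Nodup})

lemma rw_alt_sublists {α : Type*} (l : List α) (hl : l ≠ []) :
    (l.sublists'.map (fun v => (-1 : ℤ) ^ v.length)).sum = 0 := by
  cases l with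
  | nil => exact absurd rfl hl
  | cons a l =>
    rw [List.sublists'_cons, List.map_append, List.sum_append, List.map_map]
    have : ((fun v : List α => (-1 : ℤ) ^ v.length) ∘ List.cons a) =
        fun v => (-1 : ℤ) * (-1 : ℤ) ^ v.length := by
      funext v
      simp [pow_succ]
    rw [this, List.sum_map_mul_left]
    ring

lemma rw_word_bot {n : ℕ} (u : InjWord n) : u = ⊥ ↔ u.1 = [] := by
  constructor
  · rintro rfl; rfl
  · intro h; exact Subtype.ext h

lemma rw_word_mobius {n : ℕ} (w : InjWord n) (hw : w ≠ ⊥) :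
    ∑ v ∈ Finset.univ.filter (fun v => v ≤ w), (-1 : ℤ) ^ v.1.length = 0 := by
  have h1 := rw_alt_sublists w.1 (fun h => hw ((rw_word_bot w).2 h))
  rw [← List.sum_toFinset _ (List.nodup_sublists'.2 w.2)] at h1
  rw [← h1]
  refine Finset.sum_bij (fun v _ => v.1) ?_ ?_ ?_ ?_
  · intro v hv
    rw [List.mem_toFinset, List.mem_sublists']
    exact (Finset.mem_filter.1 hv).2
  · intro a _ b _ h
    exact Subtype.ext h
  · intro b hb
    rw [List.mem_toFinset, List.mem_sublists'] at hb
    exact ⟨⟨b, w.2.sublist hb⟩, Finset.mem_filter.2 ⟨Finset.mem_univ _, hb⟩, rfl⟩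
  · intro a _; rfl

lemma rw_word_eq {n : ℕ} {u v : InjWord n} (h : u ≤ v) (hl : v.1.length ≤ u.1.length) : u = v :=
  Subtype.ext (List.Sublist.eq_of_length_le h hl)

lemma rw_word_len {n : ℕ} {u v : InjWord n} (h : u ≤ v) : u.1.length ≤ v.1.length :=
  List.Sublist.length_le h

lemma rw_sublist_between {α : Type*} {u w : List α} (h : u.Sublist w) :
    ∀ t, u.length ≤ t → t ≤ w.length → ∃ v : List α, u.Sublist v ∧ v.Sublist w ∧ v.length = t := by
  induction h with
  | slnil => intro t _ ht; exact ⟨[], List.Sublist.refl _, List.Sublist.refl _, by simp at ht; simp [ht]⟩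
  | @cons u w a h ih =>
    intro t h1 h2
    rcases Nat.lt_or_ge w.length t with h3 | h3
    · refine ⟨a :: w, h.cons a, List.Sublist.refl _, ?_⟩
      simp only [List.length_cons] at h2 ⊢
      omega
    · obtain ⟨v, hv1, hv2, hv3⟩ := ih t h1 h3
      exact ⟨v, hv1, hv2.cons a, hv3⟩
  | @cons_cons u w a h ih =>
    intro t h1 h2
    simp only [List.length_cons] at h1 h2
    obtain ⟨v, hv1, hv2, hv3⟩ := ih (t - 1) (by omega) (by omega)
    refine ⟨a :: v, hv1.cons_cons a, hv2.cons_cons a, ?_⟩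
    simp only [List.length_cons]
    omega

lemma rw_word_between {n : ℕ} {u w : InjWord n} (h : u ≤ w) (t : ℕ) (h1 : u.1.length ≤ t)
    (h2 : t ≤ w.1.length) : ∃ v : InjWord n, u ≤ v ∧ v ≤ w ∧ v.1.length = t := by
  obtain ⟨v, hv1, hv2, hv3⟩ := rw_sublist_between h t h1 h2
  exact ⟨⟨v, w.2.sublist hv2⟩, hv1, hv2, hv3⟩

lemma rw_word_full {n : ℕ} (u : InjWord n) : ∃ w : InjWord n, u ≤ w ∧ w.1.length = n := by
  have hnd : (u.1 ++ (List.finRange n).filter (fun x => x ∉ u.1)).Nodup := by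
    rw [List.nodup_append']
    refine ⟨u.2, (List.nodup_finRange n).filter _, ?_⟩
    intro x hx hx'
    simp at hx'
    exact hx' hx
  refine ⟨⟨_, hnd⟩, List.sublist_append_left _ _, ?_⟩
  have h1 := List.toFinset_card_of_nodup hnd
  rw [← h1]
  have h2 : (u.1 ++ (List.finRange n).filter (fun x => x ∉ u.1)).toFinset = Finset.univ := by
    ext x
    simp only [List.mem_toFinset, List.mem_append, List.mem_filter, Finset.mem_univ, iff_true]
    by_cases hx : x ∈ u.1
    · exact Or.inl hx
    · right; simp [hx]
  rw [h2, Finset.card_univ, Fintype.card_fin]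

lemma rw_word_len_le {n : ℕ} (u : InjWord n) : u.1.length ≤ n := by
  have := u.2.length_le_card
  simpa using this

lemma rw_permWord_eq {n : ℕ} (g : Equiv.Perm (Fin n)) (u : InjWord n) :
    permWord g u = u ↔ ∀ x ∈ u.1, g x = x := by
  have h : permWord g u = u ↔ u.1.map g = u.1.map id := by
    rw [List.map_id]
    exact ⟨fun h => congrArg Subtype.val h, fun h => Subtype.ext h⟩
  rw [h, List.map_inj_left]
  rfl

/-! ### Fixed maximal chains of rank-selected subposets -/

/-- The nonempty injective words fixed by `g`. -/
def rwFix {n : ℕ} (g : Equiv.Perm (Fin n)) : Finset (InjWord n) :=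
  Finset.univ.filter fun u => u ≠ ⊥ ∧ permWord g u = u

/-- The chain of `P_n` associated to a set of words. -/
def rwPhi {n : ℕ} (D : Finset (InjWord n)) : Set (WithTop (InjWord n)) :=
  {x | x = ⊥ ∨ x = ⊤ ∨ ∃ u ∈ D, x = (u : WithTop (InjWord n))}

lemma rw_coe_bot {n : ℕ} (u : InjWord n) : (u : WithTop (InjWord n)) = ⊥ ↔ u = ⊥ := by
  rw [← WithTop.coe_bot, WithTop.coe_inj]

lemma rw_phi_coe {n : ℕ} {D : Finset (InjWord n)} {u : InjWord n} (hu : u ≠ ⊥) :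
    (u : WithTop (InjWord n)) ∈ rwPhi D ↔ u ∈ D := by
  constructor
  · rintro (h | h | ⟨v, hv, h⟩)
    · exact absurd ((rw_coe_bot u).1 h) hu
    · exact absurd h (WithTop.coe_ne_top)
    · rw [WithTop.coe_inj] at h; rw [h]; exact hv
  · intro h; exact Or.inr (Or.inr ⟨u, h, rfl⟩)

lemma rw_rk_coe {n : ℕ} (u : InjWord n) : rkInj n (u : WithTop (InjWord n)) = u.1.length := rfl

lemma rw_rk_top {n : ℕ} : rkInj n (⊤ : WithTop (InjWord n)) = n + 1 := rfl

lemma rw_chain_insert_maximal {P : Type*} [Preorder P] {A : Set P} {C : Set P}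
    (hC : C ∈ maxChainsIn A) (x : P) (hx : x ∈ A) (hcomp : ∀ y ∈ C, x ≤ y ∨ y ≤ x) : x ∈ C := by
  obtain ⟨h1, h2, h3⟩ := hC
  rw [h3 (insert x C) (Set.insert_subset hx h1) (h2.insert fun b hb _ => hcomp b hb)
    (Set.subset_insert _ _)]
  exact Set.mem_insert _ _

/-- The chains of nonempty fixed words with rank set `T`. -/
def rwChains {n : ℕ} (g : Equiv.Perm (Fin n)) (T : Finset ℕ) : Finset (Finset (InjWord n)) :=
  (rwFix g).powerset.filter fun D : Finset (InjWord n) =>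
    IsChain (· ≤ ·) (D : Set (InjWord n)) ∧ D.image (fun u => u.1.length) = T

lemma rw_mem_chains {n : ℕ} (g : Equiv.Perm (Fin n)) (T : Finset ℕ) (D : Finset (InjWord n)) :
    D ∈ rwChains g T ↔ D ⊆ rwFix g ∧ IsChain (· ≤ ·) (D : Set (InjWord n)) ∧
      D.image (fun u => u.1.length) = T := by
  unfold rwChains
  rw [Finset.mem_filter, Finset.mem_powerset]

lemma rw_fixed_chains (n : ℕ) (T : Finset ℕ) (hT : T ⊆ Finset.Icc 1 n) (g : Equiv.Perm (Fin n)) :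
    {C : Set (WithTop (InjWord n)) | C ∈ maxChainsIn (rankSel (rkInj n) T) ∧
      WithTop.map (permWord g) '' C = C} =
    rwPhi '' (↑(rwChains g T) : Set (Finset (InjWord n))) := by
  ext C
  rw [Set.mem_ofPred_eq, Set.mem_image]
  constructor
  · rintro ⟨hC, hfix⟩
    have hCA := hC.1
    have hch := hC.2.1
    have hbot : (⊥ : WithTop (InjWord n)) ∈ C :=
      rw_chain_insert_maximal hC ⊥ (Or.inr (Or.inl rfl)) (fun y _ => Or.inl bot_le)
    have htop : (⊤ : WithTop (InjWord n)) ∈ C :=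
      rw_chain_insert_maximal hC ⊤ (Or.inr (Or.inr rfl)) (fun y _ => Or.inr le_top)
    have hcmp : ∀ u v : InjWord n, (u : WithTop (InjWord n)) ∈ C → (v : WithTop (InjWord n)) ∈ C →
        u ≤ v ∨ v ≤ u := by
      intro u v hu hv
      rcases hch.total hu hv with h | h
      · exact Or.inl (WithTop.coe_le_coe.1 h)
      · exact Or.inr (WithTop.coe_le_coe.1 h)
    set D : Finset (InjWord n) := Finset.univ.filter fun u => u ≠ ⊥ ∧ (u : WithTop (InjWord n)) ∈ C
      with hD
    have hDmem : ∀ u, u ∈ D ↔ u ≠ ⊥ ∧ (u : WithTop (InjWord n)) ∈ C := by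
      intro u; rw [hD]; simp
    have hrank : ∀ u ∈ D, u.1.length ∈ T := by
      intro u hu
      rw [hDmem] at hu
      rcases hCA hu.2 with h | h | h
      · exact h
      · exact absurd ((rw_coe_bot u).1 h) hu.1
      · exact absurd h WithTop.coe_ne_top
    refine ⟨D, ?_, ?_⟩
    · rw [Finset.mem_coe, rw_mem_chains]
      refine ⟨?_, ?_, ?_⟩
      · intro u hu
        have hu' := (hDmem u).1 hu
        refine Finset.mem_filter.2 ⟨Finset.mem_univ _, hu'.1, ?_⟩
        have h1 : ((permWord g u : InjWord n) : WithTop (InjWord n)) ∈ C := by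
          rw [← hfix]
          exact ⟨u, hu'.2, rfl⟩
        have hlen : (permWord g u).1.length = u.1.length := by
          simp [permWord]
        rcases hcmp _ _ h1 hu'.2 with h | h
        · exact rw_word_eq h hlen.ge
        · exact (rw_word_eq h hlen.le).symm
      · intro u hu v hv _
        exact hcmp u v ((hDmem u).1 hu).2 ((hDmem v).1 hv).2
      · apply Finset.Subset.antisymm
        · intro t ht
          obtain ⟨u, hu, rfl⟩ := Finset.mem_image.1 ht
          exact hrank u hu
        · intro t ht
          by_contra hcon
          have hno : ∀ u ∈ D, u.1.length ≠ t := by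
            intro u hu h
            exact hcon (Finset.mem_image.2 ⟨u, hu, h⟩)
          have htn := Finset.mem_Icc.1 (hT ht)
          have hall : ∀ x : InjWord n, x ∈ insert ⊥ D → (x : WithTop (InjWord n)) ∈ C := by
            intro x hx
            rcases Finset.mem_insert.1 hx with rfl | hx
            · exact hbot
            · exact ((hDmem x).1 hx).2
          obtain ⟨u, hu, humax⟩ := Finset.exists_max_image
            ((insert ⊥ D).filter fun x => x.1.length < t) (fun x => x.1.length)
            ⟨⊥, Finset.mem_filter.2 ⟨Finset.mem_insert_self _ _, by
              change ([] : List (Fin n)).length < t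
              simp; omega⟩⟩
          rw [Finset.mem_filter] at hu
          have hw : ∃ w : InjWord n, u ≤ w ∧ t ≤ w.1.length ∧
              ∀ x ∈ D, t < x.1.length → w ≤ x := by
            rcases (D.filter fun x => t < x.1.length).eq_empty_or_nonempty with he | hne
            · obtain ⟨w, hw1, hw2⟩ := rw_word_full u
              refine ⟨w, hw1, by omega, ?_⟩
              intro x hx hxt
              have : x ∈ (D.filter fun x => t < x.1.length) := Finset.mem_filter.2 ⟨hx, hxt⟩
              rw [he] at this
              simp at this
            · obtain ⟨w, hw, hwmin⟩ := Finset.exists_min_image _ (fun x => x.1.length) hne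
              rw [Finset.mem_filter] at hw
              refine ⟨w, ?_, by omega, ?_⟩
              · rcases hcmp u w (hall u hu.1) ((hDmem w).1 hw.1).2 with h | h
                · exact h
                · have := rw_word_len h
                  omega
              · intro x hx hxt
                have h1 := hwmin x (Finset.mem_filter.2 ⟨hx, hxt⟩)
                rcases hcmp w x ((hDmem w).1 hw.1).2 ((hDmem x).1 hx).2 with h | h
                · exact h
                · exact (rw_word_eq h h1).symm.le
          obtain ⟨w, huw, htw, hwx⟩ := hw
          obtain ⟨v, hv1, hv2, hv3⟩ := rw_word_between huw t hu.2.le htw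
          have hvC : (v : WithTop (InjWord n)) ∈ C := by
            apply rw_chain_insert_maximal hC
            · left
              change v.1.length ∈ T
              rw [hv3]; exact ht
            · intro y hy
              induction y using WithTop.recTopCoe with
              | top => exact Or.inl le_top
              | coe x =>
                rw [WithTop.coe_le_coe, WithTop.coe_le_coe]
                by_cases hx0 : x = ⊥
                · rw [hx0]; exact Or.inr bot_le
                · have hxD := (hDmem x).2 ⟨hx0, hy⟩
                  rcases lt_trichotomy x.1.length t with h | h | h
                  · right
                    have h1 := humax x (Finset.mem_filter.2 ⟨Finset.mem_insert_of_mem hxD, h⟩)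
                    rcases hcmp x u hy (hall u hu.1) with h2 | h2
                    · exact h2.trans hv1
                    · exact ((rw_word_eq h2 h1).symm.le).trans hv1
                  · exact absurd h (hno x hxD)
                  · left
                    exact hv2.trans (hwx x hxD h)
          have hv0 : v ≠ ⊥ := by
            intro h
            rw [rw_word_bot] at h
            rw [h] at hv3
            simp at hv3
            omega
          exact hno v ((hDmem v).2 ⟨hv0, hvC⟩) hv3
    · ext x
      constructor
      · rintro (rfl | rfl | ⟨u, hu, rfl⟩)
        · exact hbot
        · exact htop
        · exact ((hDmem u).1 hu).2
      · intro hx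
        induction x using WithTop.recTopCoe with
        | top => exact Or.inr (Or.inl rfl)
        | coe u =>
          by_cases h0 : u = ⊥
          · left; exact (rw_coe_bot u).2 h0
          · exact (rw_phi_coe h0).2 ((hDmem u).2 ⟨h0, hx⟩)
  · rintro ⟨D, hD, rfl⟩
    rw [Finset.mem_coe, rw_mem_chains] at hD
    obtain ⟨hDs, hch, himg⟩ := hD
    refine ⟨⟨?_, ?_, ?_⟩, ?_⟩
    · rintro x (rfl | rfl | ⟨u, hu, rfl⟩)
      · exact Or.inr (Or.inl rfl)
      · exact Or.inr (Or.inr rfl)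
      · left
        change u.1.length ∈ T
        rw [← himg]
        exact Finset.mem_image.2 ⟨u, hu, rfl⟩
    · rintro x hx y hy -
      rcases hx with rfl | rfl | ⟨u, hu, rfl⟩
      · exact Or.inl bot_le
      · exact Or.inr le_top
      · rcases hy with rfl | rfl | ⟨v, hv, rfl⟩
        · exact Or.inr bot_le
        · exact Or.inl le_top
        · change (u : WithTop (InjWord n)) ≤ v ∨ (v : WithTop (InjWord n)) ≤ u
          rw [WithTop.coe_le_coe, WithTop.coe_le_coe]
          exact hch.total hu hv
    · intro E hEA hE hsub
      apply Set.Subset.antisymm hsub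
      intro x hx
      rcases hEA hx with h | h | h
      · induction x using WithTop.recTopCoe with
        | top => exact Or.inr (Or.inl rfl)
        | coe u =>
          have h' : u.1.length ∈ T := h
          rw [← himg] at h'
          obtain ⟨v, hv, hl⟩ := Finset.mem_image.1 h'
          have hvE : (v : WithTop (InjWord n)) ∈ E := hsub (Or.inr (Or.inr ⟨v, hv, rfl⟩))
          have huv : u = v := by
            rcases hE.total hx hvE with h1 | h1
            · exact rw_word_eq (WithTop.coe_le_coe.1 h1) hl.le
            · exact (rw_word_eq (WithTop.coe_le_coe.1 h1) hl.ge).symm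
          rw [huv]
          exact Or.inr (Or.inr ⟨v, hv, rfl⟩)
      · exact Or.inl h
      · exact Or.inr (Or.inl h)
    · have hid : ∀ x ∈ rwPhi D, WithTop.map (permWord g) x = x := by
        rintro x (rfl | rfl | ⟨u, hu, rfl⟩)
        · rfl
        · rfl
        · rw [WithTop.map_coe, (Finset.mem_filter.1 (hDs hu)).2.2]
      rw [Set.image_congr hid, Set.image_id']

lemma rw_injAlpha (n : ℕ) (T : Finset ℕ) (hT : T ⊆ Finset.Icc 1 n) (g : Equiv.Perm (Fin n)) :
    injAlpha n T g = ((rwChains g T).card : ℤ) := by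
  unfold injAlpha gAlpha
  rw [rw_fixed_chains n T hT g, Set.InjOn.ncard_image, Set.ncard_coe_finset]
  intro D hD E hE h
  rw [Finset.mem_coe, rw_mem_chains] at hD hE
  ext u
  by_cases h0 : u = ⊥
  · subst h0
    have h1 : ∀ F : Finset (InjWord n), F ⊆ rwFix g → ⊥ ∉ F := by
      intro F hF hb
      exact (Finset.mem_filter.1 (hF hb)).2.1 rfl
    exact ⟨fun hu => absurd hu (h1 D hD.1), fun hu => absurd hu (h1 E hE.1)⟩
  · rw [← rw_phi_coe (D := D) h0, ← rw_phi_coe (D := E) h0, h]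

lemma rw_injBeta_chains (n : ℕ) (g : Equiv.Perm (Fin n)) :
    injBeta n (Finset.Icc 1 n) g = (-1 : ℤ) ^ n * ∑ D ∈ (rwFix g).powerset,
      (if IsChain (· ≤ ·) (D : Set (InjWord n)) then (-1 : ℤ) ^ D.card else 0) := by
  have h1 : injBeta n (Finset.Icc 1 n) g = ∑ T ∈ (Finset.Icc 1 n).powerset,
      (-1 : ℤ) ^ ((Finset.Icc 1 n).card - T.card) * injAlpha n T g := rfl
  rw [h1]
  have h2 : ∀ T ∈ (Finset.Icc 1 n).powerset,
      (-1 : ℤ) ^ ((Finset.Icc 1 n).card - T.card) * injAlpha n T g =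
      ∑ D ∈ (rwFix g).powerset, (if D.image (fun u => u.1.length) = T then
        (-1 : ℤ) ^ n * (if IsChain (· ≤ ·) (D : Set (InjWord n)) then (-1 : ℤ) ^ D.card else 0)
        else 0) := by
    intro T hT
    rw [Finset.mem_powerset] at hT
    rw [rw_injAlpha n T hT, rwChains, Finset.card_filter, Nat.cast_sum, Finset.mul_sum]
    refine Finset.sum_congr rfl fun D _ => ?_
    by_cases hc : IsChain (· ≤ ·) (D : Set (InjWord n))
    · by_cases hi : D.image (fun u => u.1.length) = T
      · rw [if_pos ⟨hc, hi⟩, if_pos hi, if_pos hc]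
        have hcard : T.card = D.card := by
          rw [← hi, Finset.card_image_of_injOn]
          intro u hu v hv huv
          rcases hc.total hu hv with h | h
          · exact rw_word_eq h (le_of_eq huv.symm)
          · exact (rw_word_eq h (le_of_eq huv)).symm
        have hle := Finset.card_le_card hT
        rw [Nat.card_Icc] at hle ⊢
        obtain ⟨m, hm⟩ := Nat.exists_eq_add_of_le (show D.card ≤ n by omega)
        rw [hcard, show n + 1 - 1 - D.card = m by omega]
        have hsq : ((-1 : ℤ) ^ D.card) * (-1 : ℤ) ^ D.card = 1 := by
          rw [← mul_pow]; simp
        have hn : (-1 : ℤ) ^ n = (-1 : ℤ) ^ D.card * (-1 : ℤ) ^ m := by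
          rw [← pow_add, ← hm]
        rw [hn]
        push_cast
        linear_combination (-(-1 : ℤ) ^ m) * hsq
      · rw [if_neg hi, if_neg (fun h => hi h.2)]; simp
    · rw [if_neg (fun h => hc h.1), if_neg hc]; simp
  rw [Finset.sum_congr rfl h2, Finset.sum_comm, Finset.mul_sum]
  refine Finset.sum_congr rfl fun D hD => ?_
  rw [Finset.sum_ite_eq, if_pos]
  rw [Finset.mem_powerset] at hD ⊢
  intro t ht
  obtain ⟨u, hu, rfl⟩ := Finset.mem_image.1 ht
  have h0 := (Finset.mem_filter.1 (hD hu)).2.1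
  rw [Finset.mem_Icc]
  refine ⟨?_, rw_word_len_le u⟩
  apply List.length_pos_of_ne_nil
  exact fun h => h0 ((rw_word_bot u).2 h)

lemma rw_card_words (n k : ℕ) (g : Equiv.Perm (Fin n)) :
    ((Finset.univ.filter fun u : InjWord n => permWord g u = u).filter
      fun u => u.1.length = k).card =
      Nat.card {e : Fin k ↪ Fin n // ∀ j, g (e j) = e j} := by
  rw [Finset.filter_filter, ← Fintype.card_subtype, ← Nat.card_eq_fintype_card]
  symm
  refine Nat.card_congr (Equiv.ofBijective
    (fun e => ⟨⟨List.ofFn e.1, List.nodup_ofFn.2 e.1.injective⟩, ?_, ?_⟩) ⟨?_, ?_⟩)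
  · refine (rw_permWord_eq _ _).2 ?_
    intro x hx
    obtain ⟨j, rfl⟩ := (List.mem_ofFn' _ _).1 hx
    exact e.2 j
  · exact List.length_ofFn
  · intro e e' h
    apply Subtype.ext
    apply DFunLike.coe_injective
    exact List.ofFn_injective (congrArg (fun u => u.1.1) h)
  · rintro ⟨⟨u, hu⟩, hfix, hlen⟩
    change u.length = k at hlen
    subst hlen
    replace hfix := (rw_permWord_eq _ _).1 hfix
    refine ⟨⟨⟨u.get, List.nodup_iff_injective_get.1 hu⟩, fun j => hfix _ (List.get_mem u j)⟩, ?_⟩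
    apply Subtype.ext
    apply Subtype.ext
    exact List.ofFn_get u

lemma rw_injBeta (n : ℕ) (g : Equiv.Perm (Fin n)) :
    injBeta n (Finset.Icc 1 n) g = ∑ k ∈ Finset.range (n + 1), (-1 : ℤ) ^ (n - k) *
      (Nat.card {e : Fin k ↪ Fin n // ∀ j, g (e j) = e j} : ℤ) := by
  rw [rw_injBeta_chains, rw_euler (fun u : InjWord n => (-1 : ℤ) ^ u.1.length) rfl
    (fun w hw => rw_word_mobius w hw)]
  rotate_left
  · intro h
    exact (Finset.mem_filter.1 h).2.1 rfl
  · intro w hw v hv hv0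
    refine Finset.mem_filter.2 ⟨Finset.mem_univ _, hv0, ?_⟩
    have h1 := (Finset.mem_filter.1 hw).2.2
    rw [rw_permWord_eq] at h1 ⊢
    exact fun x hx => h1 x (List.Sublist.subset hv hx)
  have hfull : (Finset.univ.filter fun u : InjWord n => permWord g u = u) =
      insert ⊥ (rwFix g) := by
    ext u
    unfold rwFix
    simp only [Finset.mem_filter, Finset.mem_univ, true_and, Finset.mem_insert]
    constructor
    · intro h
      by_cases h0 : u = ⊥
      · exact Or.inl h0
      · exact Or.inr ⟨h0, h⟩
    · rintro (rfl | h)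
      · rfl
      · exact h.2
  have h1 : 1 + ∑ w ∈ rwFix g, (-1 : ℤ) ^ w.1.length =
      ∑ w ∈ (Finset.univ.filter fun u : InjWord n => permWord g u = u), (-1 : ℤ) ^ w.1.length := by
    rw [hfull, Finset.sum_insert]
    · rfl
    · intro h
      exact (Finset.mem_filter.1 h).2.1 rfl
  rw [h1, ← Finset.sum_fiberwise_of_maps_to (t := Finset.range (n + 1))
    (g := fun u : InjWord n => u.1.length)
    (fun u _ => Finset.mem_range.2 (Nat.lt_succ_of_le (rw_word_len_le u))), Finset.mul_sum]
  refine Finset.sum_congr rfl fun k hk => ?_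
  rw [Finset.sum_congr rfl (fun u hu => by rw [(Finset.mem_filter.1 hu).2]), Finset.sum_const,
    rw_card_words, nsmul_eq_mul]
  rw [Finset.mem_range] at hk
  obtain ⟨m, rfl⟩ := Nat.exists_eq_add_of_le (show k ≤ n by omega)
  have hsq : ((-1 : ℤ) ^ k) * (-1 : ℤ) ^ k = 1 := by
    rw [← mul_pow]; simp
  rw [show k + m - k = m by omega, pow_add]
  linear_combination ((-1 : ℤ) ^ m *
    (Nat.card {e : Fin k ↪ Fin (k + m) // ∀ j, g (e j) = e j} : ℤ)) * hsq

/-! ### Conclusion -/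

lemma rw_sum_rowLen (μ : YoungDiagram) (l : ℕ) (hl : μ.rowLen l = 0) :
    ∑ i : Fin l, μ.rowLen (i : ℕ) = μ.card := by
  rw [Fin.sum_univ_eq_sum_range (fun i => μ.rowLen i)]
  unfold YoungDiagram.card
  rw [Finset.card_eq_sum_card_fiberwise (f := Prod.fst) (t := Finset.range l)]
  · refine Finset.sum_congr rfl fun i _ => ?_
    rw [YoungDiagram.rowLen_eq_card]
    rfl
  · rintro ⟨i, j⟩ hij
    have h1 : (i, j) ∈ μ := hij
    rw [YoungDiagram.mem_iff_lt_rowLen] at h1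
    by_contra hcon
    have h2 : l ≤ i := by simpa using hcon
    have := μ.rowLen_anti _ _ h2
    omega

lemma rw_rowLen_length (μ : YoungDiagram) : μ.rowLen μ.rowLens.length = 0 := by
  rw [YoungDiagram.length_rowLens]
  by_contra h
  have h1 : (μ.colLen 0, 0) ∈ μ := by rw [YoungDiagram.mem_iff_lt_rowLen]; omega
  rw [YoungDiagram.mem_iff_lt_colLen] at h1
  omega

lemma rw_main (n : ℕ) (μ : YoungDiagram) (hμ : μ.card = n) :
    (∑ g : Equiv.Perm (Fin n), injBeta n (Finset.Icc 1 n) g * chi n μ g⁻¹) =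
      (Nat.card {Q : SYT μ //
          Even ((insert n Q.des).min' (Finset.insert_nonempty n Q.des))} : ℤ) *
        (n.factorial : ℤ) := by
  have hl := rw_rowLen_length μ
  rw [← rw_alt_sum n μ hμ, ← Finset.sum_range_reflect, Finset.sum_mul]
  simp only [rw_injBeta, Finset.sum_mul]
  rw [Finset.sum_comm]
  refine Finset.sum_congr rfl fun k hk => ?_
  rw [Finset.mem_range] at hk
  rw [show n + 1 - 1 - k = n - k by omega, ← rw_JT_eq k (n - k) _ μ (by omega) hl]
  unfold chi rwJT
  simp only [Finset.mul_sum, Finset.sum_mul]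
  rw [Finset.sum_comm]
  refine Finset.sum_congr rfl fun σ _ => ?_
  have hsum : ∑ i : Fin μ.rowLens.length,
      (((μ.rowLen (i : ℕ) : ℕ) : ℤ) - ((i : ℕ) : ℤ) + ((σ i : ℕ) : ℤ)) = n := by
    rw [Finset.sum_add_distrib, Finset.sum_sub_distrib,
      Equiv.sum_comp σ (fun i => ((i : ℕ) : ℤ)), sub_add_cancel, ← Nat.cast_sum,
      rw_sum_rowLen μ _ hl, hμ]
  have hb := rw_burnside n k μ.rowLens.length _ hsum
  rw [mul_assoc, mul_assoc, ← hb, Finset.mul_sum, Finset.mul_sum]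
  refine Finset.sum_congr rfl fun g _ => ?_
  ring

end

/-- **Reiner–Webb** (Theorem 1.1).  For `T = {1,…,n}`, the multiplicity of the irreducible
`𝔖_n`-representation `ρ^μ` in `β_{P_n}(T)` equals the number of standard Young tableaux
`Q` of shape `μ` for which the smallest element of `Des(Q) ∪ {n}` is even.
(The multiplicity `M` of `ρ^μ` in a virtual representation with character `φ` is
characterized by `Σ_g φ(g) χ^μ(g⁻¹) = M * n!`.) -/
theorem statement0 (n : ℕ) (hn : 0 < n) (μ : YoungDiagram) (hμ : μ.card = n) :
    (∑ g : Equiv.Perm (Fin n), injBeta n (Finset.Icc 1 n) g * chi n μ g⁻¹) =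
      (Nat.card {Q : SYT μ //
          Even ((insert n Q.des).min' (Finset.insert_nonempty n Q.des))} : ℤ) *
        (n.factorial : ℤ) := by
  exact rw_main n μ hμ
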